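/- arXiv:math/9902020 — 3 statements merged into one kernel-verified Lean document; each statement's English description precedes it below -/
import Mathlib

section
/- For n even and all k ≥ 1, U(n,k−1)·U(n,k+1) ≤ U(n,k)², where U(n,k) is the number of half-ascending permutations of {1,...,n} with exactly k descents. -/
open Finset

/-- The value of the permutation `p` at (0-indexed) position `i`, as a natural number. -/
def permVal (n : ℕ) (p : Equiv.Perm (Fin n)) (i : ℕ) : ℕ :=
  if h : i < n then (p ⟨i, h⟩ : ℕ) else 0

/-- `p` changes direction at 0-indexed interior position `i` (peak or valley). -/
def dirChange (n : ℕ) (p : Equiv.Perm (Fin n)) (i : ℕ) : Prop :=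
  (permVal n p (i-1) < permVal n p i ∧ permVal n p (i+1) < permVal n p i) ∨
  (permVal n p i < permVal n p (i-1) ∧ permVal n p i < permVal n p (i+1))

instance (n : ℕ) (p : Equiv.Perm (Fin n)) : DecidablePred (dirChange n p) := fun i => by
  unfold dirChange; infer_instance

/-- Number of runs of a permutation: one more than the number of interior direction changes. -/
def numRuns (n : ℕ) (p : Equiv.Perm (Fin n)) : ℕ :=
  ((Finset.Ico 1 (n-1)).filter (dirChange n p)).card + 1

/-- `R n k` is the number of permutations of `{1,...,n}` with exactly `k` runs. -/
def R (n k : ℕ) : ℕ :=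
  (Finset.univ.filter (fun p : Equiv.Perm (Fin n) => numRuns n p = k)).card

/-- Number of descents of a permutation. -/
def numDescents (n : ℕ) (p : Equiv.Perm (Fin n)) : ℕ :=
  ((Finset.range (n-1)).filter (fun i => permVal n p (i+1) < permVal n p i)).card

/-- `A n k`: Eulerian numbers, counting permutations with `k` descents. -/
def A (n k : ℕ) : ℕ :=
  (Finset.univ.filter (fun p : Equiv.Perm (Fin n) => numDescents n p = k)).card

/-- The run-generating polynomial `R_n(x) = Σ_k R(n,k) x^k`. -/
noncomputable def Rpoly (n : ℕ) : Polynomial ℤ :=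
  ∑ k ∈ Finset.range n, Polynomial.C ((R n k : ℤ)) * Polynomial.X ^ k

/-- `p` is `j`-half-ascending: `p_{n+1-2i} < p_{n+2-2i}` (1-indexed) for all `1 ≤ i ≤ j`. -/
def HalfAscJ (n j : ℕ) (p : Equiv.Perm (Fin n)) : Prop :=
  ∀ i ∈ Finset.Icc 1 j, permVal n p (n - 2*i) < permVal n p (n + 1 - 2*i)

instance (n j : ℕ) : DecidablePred (HalfAscJ n j) := fun p => by
  unfold HalfAscJ; infer_instance

/-- For `n` even: `p` is half-ascending if `p_{2i-1} < p_{2i}` (1-indexed) for `1 ≤ i ≤ n/2`. -/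
def HalfAsc (n : ℕ) (p : Equiv.Perm (Fin n)) : Prop :=
  ∀ i ∈ Finset.range (n/2), permVal n p (2*i) < permVal n p (2*i+1)

instance (n : ℕ) : DecidablePred (HalfAsc n) := fun p => by
  unfold HalfAsc; infer_instance

/-- `U n k`: number of half-ascending permutations with exactly `k` descents. -/
def U (n k : ℕ) : ℕ :=
  (Finset.univ.filter (fun p : Equiv.Perm (Fin n) =>
    HalfAsc n p ∧ numDescents n p = k)).card

/-- Number of runs of the prefix `p_1, ..., p_L` (1-indexed). -/
def prefixRuns (n L : ℕ) (p : Equiv.Perm (Fin n)) : ℕ :=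
  ((Finset.Ico 1 (L-1)).filter (dirChange n p)).card + 1

/-- Number of descents of the suffix starting at 0-indexed position `a`. -/
def suffixDescents (n a : ℕ) (p : Equiv.Perm (Fin n)) : ℕ :=
  ((Finset.Ico a (n-1)).filter (fun i => permVal n p (i+1) < permVal n p i)).card

/-- `t_j(p) = r_j(p) + s_j(p)`: runs of the prefix `p_1..p_{n-2j}` plus descents of the
suffix `p_{n-2j}..p_n`. -/
def tstat (n j : ℕ) (p : Equiv.Perm (Fin n)) : ℕ :=
  prefixRuns n (n - 2*j) p + suffixDescents n (n - 2*j - 1) p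

/-- `R_{n,j}(x) = Σ_p x^{t_j(p)}` over `j`-half-ascending permutations `p`. -/
noncomputable def RpolyJ (n j : ℕ) : Polynomial ℤ :=
  ∑ p ∈ Finset.univ.filter (HalfAscJ n j), Polynomial.X ^ (tstat n j p)

/-- A labeled northeastern lattice path with `n` edges, encoded as a function assigning to the
`i`-th edge (0-indexed; the paper's edge `a_{i+1}`) a direction (`true` = vertical) and a label.
Conditions (1)-(3) of the paper. -/
def IsLPath (n : ℕ) (f : Fin n → Bool × ℕ) : Prop :=
  (∀ i : Fin n, 1 ≤ (f i).2) ∧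
  (∀ h : 0 < n, (f ⟨0, h⟩).1 = false ∧ (f ⟨0, h⟩).2 = 1) ∧
  (∀ i : ℕ, (h : i + 1 < n) →
    ((f ⟨i, Nat.lt_of_succ_lt h⟩).1 = (f ⟨i+1, h⟩).1 →
      (f ⟨i+1, h⟩).2 ≤ (f ⟨i, Nat.lt_of_succ_lt h⟩).2) ∧
    ((f ⟨i, Nat.lt_of_succ_lt h⟩).1 ≠ (f ⟨i+1, h⟩).1 →
      (f ⟨i, Nat.lt_of_succ_lt h⟩).2 + (f ⟨i+1, h⟩).2 ≤ i + 2))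

/-- The number of vertical edges of a labeled lattice path. -/
def vertCount (n : ℕ) (f : Fin n → Bool × ℕ) : ℕ :=
  (Finset.univ.filter (fun i : Fin n => (f i).1 = true)).card

section PartA

/-- weight of a permutation -/
noncomputable def hwt (t : ℝ) (n : ℕ) (p : Equiv.Perm (Fin n)) : ℝ :=
  ∏ i ∈ Finset.range (n-1),
    if permVal n p (i+1) < permVal n p i then (if Even i then 0 else t) else 1

lemma hwt_eq (t : ℝ) (n : ℕ) (hn : Even n) (p : Equiv.Perm (Fin n)) :
    hwt t n p = if HalfAsc n p then t ^ numDescents n p else 0 := by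
  obtain ⟨m, rfl⟩ := hn
  unfold hwt
  split_ifs with h
  · unfold numDescents
    rw [← Finset.prod_const, Finset.prod_filter]
    apply Finset.prod_congr rfl
    intro i hi
    by_cases hd : permVal (m+m) p (i+1) < permVal (m+m) p i
    · rw [if_pos hd, if_pos hd, if_neg]
      rintro ⟨a, rfl⟩
      have := h a (by simp at hi ⊢; omega)
      rw [show 2 * a = a + a by ring] at this
      omega
    · rw [if_neg hd, if_neg hd]
  · unfold HalfAsc at h
    push Not at h
    obtain ⟨a, ha, hle⟩ := h
    apply Finset.prod_eq_zero (i := 2 * a)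
    · simp at ha ⊢; omega
    · have : permVal (m+m) p (2*a+1) ≠ permVal (m+m) p (2*a) := by
        unfold permVal
        simp at ha
        rw [dif_pos (by omega), dif_pos (by omega)]
        intro h
        have := p.injective (Fin.ext h)
        simp at this
      rw [if_pos (by omega), if_pos (by simp)]

lemma numDescents_lt (n : ℕ) (p : Equiv.Perm (Fin n)) : numDescents n p < n + 1 := by
  unfold numDescents
  have := Finset.card_filter_le (Finset.range (n-1)) (fun i => permVal n p (i+1) < permVal n p i)
  simp at this
  omega

lemma sum_hwt (t : ℝ) (n : ℕ) (hn : Even n) :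
    ∑ p, hwt t n p = ∑ k ∈ Finset.range (n+1), (U n k : ℝ) * t ^ k := by
  simp_rw [hwt_eq t n hn]
  rw [← Finset.sum_filter]
  rw [← Finset.sum_fiberwise_of_maps_to (t := Finset.range (n+1)) (g := numDescents n)
    (fun p _ => by simpa using numDescents_lt n p)]
  apply Finset.sum_congr rfl
  intro k _
  rw [Finset.filter_filter, U, ← nsmul_eq_mul, ← Finset.sum_const]
  apply Finset.sum_congr rfl
  intro p hp
  simp at hp
  rw [hp.2]

/-- extend a permutation by a last value -/
def pext {n : ℕ} (j : Fin (n+1)) (q : Equiv.Perm (Fin n)) : Equiv.Perm (Fin (n+1)) :=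
  (finSuccEquiv' (Fin.last n)).trans ((Equiv.optionCongr q).trans (finSuccEquiv' j).symm)

lemma pext_last {n : ℕ} (j : Fin (n+1)) (q : Equiv.Perm (Fin n)) :
    pext j q (Fin.last n) = j := by
  simp [pext]

lemma pext_castSucc {n : ℕ} (j : Fin (n+1)) (q : Equiv.Perm (Fin n)) (i : Fin n) :
    pext j q i.castSucc = j.succAbove (q i) := by
  have h : finSuccEquiv' (Fin.last n) i.castSucc = some i := by
    rw [← Fin.succAbove_last]
    exact finSuccEquiv'_succAbove _ _
  simp [pext, h]

lemma pext_bij (n : ℕ) : Function.Bijective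
    (fun x : Fin (n+1) × Equiv.Perm (Fin n) => pext x.1 x.2) := by
  rw [Fintype.bijective_iff_injective_and_card]
  constructor
  · rintro ⟨j, q⟩ ⟨j', q'⟩ h
    simp only at h
    have h1 : j = j' := by rw [← pext_last j q, h, pext_last]
    subst h1
    congr 1
    ext i
    have := pext_castSucc j q i
    rw [h, pext_castSucc] at this
    rw [Fin.succAbove_right_injective this]
  · simp [Fintype.card_perm, Nat.factorial_succ]

lemma permVal_pext_last {n : ℕ} (j : Fin (n+1)) (q : Equiv.Perm (Fin n)) :
    permVal (n+1) (pext j q) n = j := by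
  unfold permVal
  rw [dif_pos (by omega)]
  exact congrArg Fin.val (pext_last j q)

lemma permVal_pext {n : ℕ} (j : Fin (n+1)) (q : Equiv.Perm (Fin n)) (i : ℕ) (hi : i < n) :
    permVal (n+1) (pext j q) i =
      if permVal n q i < j then permVal n q i else permVal n q i + 1 := by
  unfold permVal
  rw [dif_pos (by omega), dif_pos hi]
  have := congrArg Fin.val (pext_castSucc j q ⟨i, hi⟩)
  refine Eq.trans this ?_
  rw [Fin.succAbove]
  simp only [Fin.lt_def, Fin.val_castSucc]
  split_ifs <;> simp

lemma hwt_pext (t : ℝ) {n : ℕ} (j : Fin (n+2)) (q : Equiv.Perm (Fin (n+1))) :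
    hwt t (n+2) (pext j q) = hwt t (n+1) q *
      (if (j : ℕ) ≤ permVal (n+1) q n then (if Even n then 0 else t) else 1) := by
  unfold hwt
  rw [show n + 2 - 1 = n + 1 from rfl, show n + 1 - 1 = n from rfl, Finset.prod_range_succ]
  congr 1
  · apply Finset.prod_congr rfl
    intro i hi
    simp at hi
    rw [permVal_pext j q i (by omega), permVal_pext j q (i+1) (by omega)]
    congr 1
    apply propext
    split_ifs <;> omega
  · rw [permVal_pext j q n (by omega), permVal_pext_last]
    congr 1
    apply propext
    split_ifs <;> omega

/-- refined counts -/
noncomputable def Fr (t : ℝ) : ℕ → ℕ → ℝ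
  | 0, _ => 1
  | n+1, j => ∑ l ∈ Finset.range (n+1),
      Fr t n l * (if j ≤ l then (if Even n then 0 else t) else 1)

lemma sum_hwt_g (t : ℝ) (n : ℕ) (g : ℕ → ℝ) :
    ∑ p : Equiv.Perm (Fin (n+1)), hwt t (n+1) p * g (permVal (n+1) p n) =
      ∑ j ∈ Finset.range (n+1), Fr t n j * g j := by
  induction n generalizing g with
  | zero =>
    simp [Fr, hwt, permVal]
  | succ n ih =>
    rw [← (pext_bij (n+1)).sum_comp, Fintype.sum_prod_type, Finset.sum_range]
    apply Finset.sum_congr rfl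
    intro j _
    simp_rw [hwt_pext, permVal_pext_last]
    rw [← Finset.sum_mul, ih (fun l => if (j:ℕ) ≤ l then (if Even n then 0 else t) else 1), Fr]

/-- `t * U(t)` with convention `1` at zero -/
noncomputable def Wr (t : ℝ) : ℕ → ℝ
  | 0 => 1
  | m+1 => t * ∑ j ∈ Finset.range (2*m+2), Fr t (2*m+1) j

lemma sum_choose_real (j a : ℕ) :
    ∑ l ∈ Finset.range j, (l.choose a : ℝ) = (j.choose (a+1) : ℝ) := by
  induction j with
  | zero => simp
  | succ j ih => rw [Finset.sum_range_succ, ih, Nat.choose_succ_succ]; push_cast; ring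

lemma sum_ite_lt (f : ℕ → ℝ) (c : ℝ) (N j : ℕ) (h : j ≤ N) :
    ∑ l ∈ Finset.range N, f l * (if j ≤ l then c else 1) =
      c * ∑ l ∈ Finset.range N, f l + (1 - c) * ∑ l ∈ Finset.range j, f l := by
  obtain ⟨d, rfl⟩ := Nat.exists_eq_add_of_le h
  rw [Finset.sum_range_add, Finset.sum_range_add]
  have h1 : ∑ l ∈ Finset.range j, f l * (if j ≤ l then c else 1) = ∑ l ∈ Finset.range j, f l := by
    apply Finset.sum_congr rfl
    intro l hl
    simp at hl
    rw [if_neg (by omega), mul_one]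
  have h2 : ∑ l ∈ Finset.range d, f (j+l) * (if j ≤ j+l then c else 1)
      = c * ∑ l ∈ Finset.range d, f (j+l) := by
    rw [Finset.mul_sum]
    apply Finset.sum_congr rfl
    intro l hl
    rw [if_pos (by omega), mul_comm]
  rw [h1, h2]; ring

lemma Fr_odd_of_even (t : ℝ) (m : ℕ)
    (h : ∀ j ≤ 2*m, Fr t (2*m) j = ∑ i ∈ Finset.range (m+1),
      (1-t)^i * (j.choose (2*i) : ℝ) * Wr t (m-i)) (j : ℕ) (hj : j ≤ 2*m+1) :
    Fr t (2*m+1) j = ∑ i ∈ Finset.range (m+1),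
      (1-t)^i * (j.choose (2*i+1) : ℝ) * Wr t (m-i) := by
  rw [Fr, if_pos (by simp), sum_ite_lt _ _ _ _ hj, zero_mul, zero_add, sub_zero, one_mul]
  rw [Finset.sum_congr rfl (fun l hl => h l (by simp at hl; omega)), Finset.sum_comm]
  apply Finset.sum_congr rfl
  intro i _
  rw [← Finset.sum_mul, ← Finset.mul_sum, sum_choose_real]

lemma Fr_even (t : ℝ) (m : ℕ) :
    ∀ j ≤ 2*m, Fr t (2*m) j = ∑ i ∈ Finset.range (m+1),
      (1-t)^i * (j.choose (2*i) : ℝ) * Wr t (m-i) := by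
  induction m with
  | zero => intro j hj; simp [Fr, Wr]
  | succ m ih =>
    intro j hj
    rw [show 2 * (m+1) = (2*m+1)+1 by ring, Fr, if_neg (by simp), sum_ite_lt _ _ _ _ (by omega)]
    have hW : t * ∑ l ∈ Finset.range (2*m+1+1), Fr t (2*m+1) l = Wr t (m+1) := by rw [Wr]
    rw [hW, Finset.sum_congr rfl (fun l hl => Fr_odd_of_even t m ih l (by simp at hl; omega)),
      Finset.sum_comm, add_comm, Finset.mul_sum, Finset.sum_range_succ' _ (m+1)]
    congr 1
    · apply Finset.sum_congr rfl
      intro i _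
      rw [← Finset.sum_mul, ← Finset.mul_sum, sum_choose_real, Nat.add_sub_add_right,
        show 2*(i+1) = 2*i+1+1 by ring]
      ring
    · simp

lemma Wr_succ (t : ℝ) (m : ℕ) :
    Wr t (m+1) = t * ∑ i ∈ Finset.range (m+1),
      (1-t)^i * ((2*m+2).choose (2*i+2) : ℝ) * Wr t (m-i) := by
  rw [Wr, Finset.sum_congr rfl
    (fun l hl => Fr_odd_of_even t m (Fr_even t m) l (by simp at hl; omega)), Finset.sum_comm]
  congr 1
  apply Finset.sum_congr rfl
  intro i _
  rw [← Finset.sum_mul, ← Finset.mul_sum, sum_choose_real]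

lemma Wr_eq_U (t : ℝ) (m : ℕ) :
    Wr t (m+1) = t * ∑ k ∈ Finset.range (2*m+3), (U (2*m+2) k : ℝ) * t ^ k := by
  rw [Wr, ← sum_hwt t (2*m+2) ⟨m+1, by ring⟩]
  congr 1
  have := sum_hwt_g t (2*m+1) (fun _ => 1)
  simp only [mul_one] at this
  exact this.symm

end PartA

section PartB
open PowerSeries in
/-- `∑_{i ≥ 1} z^i/(2i)!` -/
noncomputable def yser : PowerSeries ℝ :=
  PowerSeries.mk fun i => if i = 0 then 0 else (1 : ℝ) / ((2*i).factorial : ℝ)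

open PowerSeries in
lemma yser_ode : 4 * X * (d⁄dX ℝ (d⁄dX ℝ yser)) + 2 * d⁄dX ℝ yser = yser + 1 := by
  ext n
  rw [show (4 : PowerSeries ℝ) = C 4 from (map_ofNat C 4).symm,
    show (2 : PowerSeries ℝ) = C 2 from (map_ofNat C 2).symm, mul_assoc]
  simp only [map_add, coeff_C_mul]
  rcases n with _ | n
  · simp [coeff_derivative, yser]
  · simp only [coeff_succ_X_mul, coeff_derivative, yser, coeff_mk, coeff_one]
    have h : ((2*(n+1+1)).factorial : ℝ) = (2*n+4)*(2*n+3)*((2*(n+1)).factorial : ℝ) := by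
      rw [show 2*(n+1+1) = 2*(n+1)+1+1 by ring, Nat.factorial_succ, Nat.factorial_succ]
      push_cast; ring
    have h0 : ((2*(n+1)).factorial : ℝ) ≠ 0 := by positivity
    have h3 : (2*(n:ℝ)+4) ≠ 0 := by positivity
    have h4 : (2*(n:ℝ)+3) ≠ 0 := by positivity
    simp only [h, Nat.add_eq_zero_iff, one_ne_zero, and_false, if_false]
    push_cast
    field_simp
    ring

open PowerSeries in
lemma yser_sq : 4 * X * (d⁄dX ℝ yser)^2 = yser^2 + 2 * yser := by
  apply derivative.ext
  · have h := yser_ode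
    set y := yser
    have e1 : d⁄dX ℝ (4 * X * (d⁄dX ℝ y)^2) =
        2 * d⁄dX ℝ y * (4 * X * (d⁄dX ℝ (d⁄dX ℝ y)) + 2 * d⁄dX ℝ y) := by
      have h4 : d⁄dX ℝ (4 : PowerSeries ℝ) = 0 := by
        rw [show (4 : PowerSeries ℝ) = C 4 from (map_ofNat C 4).symm, derivative_C]
      rw [Derivation.leibniz, Derivation.leibniz, Derivation.leibniz_pow, h4, derivative_X]
      simp only [smul_eq_mul, nsmul_eq_mul]
      push_cast
      ring
    have e2 : d⁄dX ℝ (y^2 + 2 * y) = 2 * d⁄dX ℝ y * (y + 1) := by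
      have h2 : d⁄dX ℝ (2 : PowerSeries ℝ) = 0 := by
        rw [show (2 : PowerSeries ℝ) = C 2 from (map_ofNat C 2).symm, derivative_C]
      rw [map_add, Derivation.leibniz, Derivation.leibniz_pow, h2]
      simp only [smul_eq_mul, nsmul_eq_mul]
      push_cast
      ring
    rw [e1, e2, h]
  · have : constantCoeff yser = 0 := by
      rw [← coeff_zero_eq_constantCoeff_apply]; simp [yser]
    simp [this]

open PowerSeries in
lemma yser_pow_ode (k : ℕ) :
    4 * X * (d⁄dX ℝ (d⁄dX ℝ (yser^(k+1)))) + 2 * d⁄dX ℝ (yser^(k+1)) =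
      ((k:PowerSeries ℝ)+1)^2 * yser^(k+1) + ((k:PowerSeries ℝ)+1)*(2*(k:PowerSeries ℝ)+1) * yser^k := by
  have h := yser_ode
  have h2 := yser_sq
  set y := yser
  have hk : d⁄dX ℝ ((k : PowerSeries ℝ) + 1) = 0 := by
    rw [map_add, Derivation.map_natCast]; simp
  have e1 : d⁄dX ℝ (y^(k+1)) = ((k:PowerSeries ℝ)+1) * (y^k * d⁄dX ℝ y) := by
    rw [Derivation.leibniz_pow]
    simp only [smul_eq_mul, nsmul_eq_mul]
    push_cast
    simp
  have e2 : d⁄dX ℝ (d⁄dX ℝ (y^(k+1))) = ((k:PowerSeries ℝ)+1) *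
      (k * y^(k-1) * (d⁄dX ℝ y)^2 + y^k * d⁄dX ℝ (d⁄dX ℝ y)) := by
    rw [e1, Derivation.leibniz, Derivation.leibniz, Derivation.leibniz_pow, hk]
    simp only [smul_eq_mul, nsmul_eq_mul]
    ring
  rw [e2, e1]
  rcases k with _ | k
  · simp
    linear_combination h
  · rw [Nat.add_sub_cancel]
    push_cast
    linear_combination ((k:PowerSeries ℝ)+1+1) * y^(k+1) * h +
      ((k:PowerSeries ℝ)+1+1) * (k+1) * y^k * h2

open Polynomial

/-- the polynomials `P_m` -/
noncomputable def Pp : ℕ → ℝ[X]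
  | 0 => 1
  | m+1 => X * derivative (X * (Pp m + (1 + 2 * X) * derivative (Pp m)))

lemma Pp_coeff_zero (m : ℕ) : (Pp (m+1)).coeff 0 = 0 := by simp [Pp]

lemma Pp_coeff_succ (m k : ℕ) : (Pp (m+1)).coeff (k+1) =
    ((k:ℝ)+1)^2 * (Pp m).coeff (k+1) + ((k:ℝ)+1)*(2*k+1) * (Pp m).coeff k := by
  rw [Pp, coeff_X_mul, coeff_derivative, coeff_X_mul, add_mul, one_mul, mul_assoc]
  rw [show (2 : ℝ[X]) = C 2 from (map_ofNat C 2).symm]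
  simp only [coeff_add, coeff_C_mul, coeff_derivative]
  rcases k with _ | k
  · simp; ring
  · simp only [coeff_X_mul, coeff_derivative]; push_cast; ring

lemma Pp_coeff (m k : ℕ) : (Pp m).coeff k =
    ((2*m).factorial : ℝ) * PowerSeries.coeff m (yser^k) := by
  induction m generalizing k with
  | zero =>
    have : PowerSeries.constantCoeff yser = 0 := by
      rw [← PowerSeries.coeff_zero_eq_constantCoeff_apply]; simp [yser]
    rw [PowerSeries.coeff_zero_eq_constantCoeff_apply, map_pow, this]
    simp [Pp, coeff_one, zero_pow_eq]
  | succ m ih =>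
    rcases k with _ | k
    · simp [Pp_coeff_zero, PowerSeries.coeff_one]
    · rw [Pp_coeff_succ, ih, ih]
      have h := congrArg (PowerSeries.coeff m) (yser_pow_ode k)
      rw [show (4 : PowerSeries ℝ) = PowerSeries.C 4 from (map_ofNat PowerSeries.C 4).symm,
        show ((k:PowerSeries ℝ)+1)^2 = PowerSeries.C (((k:ℝ)+1)^2) by simp,
        show ((k:PowerSeries ℝ)+1)*(2*(k:PowerSeries ℝ)+1) = PowerSeries.C (((k:ℝ)+1)*(2*k+1)) by
          simp only [map_mul, map_add, map_natCast, map_ofNat, map_one],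
        show (2 : PowerSeries ℝ) = PowerSeries.C 2 from (map_ofNat PowerSeries.C 2).symm,
        mul_assoc] at h
      simp only [map_add, PowerSeries.coeff_C_mul] at h
      have hf : ((2*(m+1)).factorial : ℝ) = (2*m+2)*(2*m+1)*((2*m).factorial : ℝ) := by
        rw [show 2*(m+1) = 2*m+1+1 by ring, Nat.factorial_succ, Nat.factorial_succ]
        push_cast; ring
      rw [hf]
      have key : (4 * (PowerSeries.coeff m) (PowerSeries.X * (PowerSeries.derivative ℝ)
          ((PowerSeries.derivative ℝ) (yser ^ (k + 1)))) +
          2 * (PowerSeries.coeff m) ((PowerSeries.derivative ℝ) (yser ^ (k + 1)))) =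
          (2*m+2)*(2*m+1) * (PowerSeries.coeff (m+1)) (yser ^ (k+1)) := by
        rcases m with _ | m
        · rw [PowerSeries.coeff_zero_X_mul, PowerSeries.coeff_derivative]
          push_cast; ring
        · rw [PowerSeries.coeff_succ_X_mul]
          simp only [PowerSeries.coeff_derivative]
          push_cast; ring
      rw [key] at h
      linear_combination -((2*m).factorial : ℝ) * h

lemma Pp_conv (m : ℕ) : Pp (m+1) = X * ∑ i ∈ Finset.range (m+1),
    C ((2*m+2).choose (2*i+2) : ℝ) * Pp (m-i) := by
  ext k
  rcases k with _ | k
  · simp [Pp_coeff_zero]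
  · rw [coeff_X_mul, finsetSum_coeff, Pp_coeff, pow_succ', PowerSeries.coeff_mul,
      Finset.Nat.sum_antidiagonal_eq_sum_range_succ
        (fun a b => PowerSeries.coeff a yser * PowerSeries.coeff b (yser^k)),
      Finset.sum_range_succ']
    have h0 : PowerSeries.coeff 0 yser = 0 := by simp [yser]
    rw [h0, zero_mul, add_zero, Finset.mul_sum]
    apply Finset.sum_congr rfl
    intro i hi
    simp at hi
    rw [coeff_C_mul, Pp_coeff, Nat.add_sub_add_right]
    have : PowerSeries.coeff (i+1) yser = 1 / ((2*i+2).factorial : ℝ) := by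
      simp [yser, mul_add]
    rw [this, Nat.cast_choose ℝ (show 2*i+2 ≤ 2*m+2 by omega),
      show 2*m+2 - (2*i+2) = 2*(m-i) by omega, show 2*(m+1) = 2*m+2 by ring]
    have h1 : ((2*i+2).factorial : ℝ) ≠ 0 := by positivity
    have h2 : ((2*(m-i)).factorial : ℝ) ≠ 0 := by positivity
    field_simp

lemma Pp_nonneg (m k : ℕ) : 0 ≤ (Pp m).coeff k := by
  induction m generalizing k with
  | zero => simp [Pp, coeff_one]; split_ifs <;> simp
  | succ m ih =>
    rcases k with _ | k
    · rw [Pp_coeff_zero]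
    · rw [Pp_coeff_succ]
      have := ih k
      have := ih (k+1)
      positivity

lemma Pp_top (m : ℕ) : 0 < (Pp m).coeff m ∧ ∀ k, m < k → (Pp m).coeff k = 0 := by
  induction m with
  | zero => simp [Pp, coeff_one]; intro k h h2; omega
  | succ m ih =>
    constructor
    · rw [Pp_coeff_succ, ih.2 _ (by omega)]
      have := ih.1
      positivity
    · intro k hk
      obtain ⟨k, rfl⟩ : ∃ l, k = l+1 := ⟨k-1, by omega⟩
      rw [Pp_coeff_succ, ih.2 _ (by omega), ih.2 _ (by omega)]; ring

lemma Pp_natDegree (m : ℕ) : (Pp m).natDegree = m :=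
  le_antisymm (natDegree_le_iff_coeff_eq_zero.2 (Pp_top m).2)
    (le_natDegree_of_ne_zero (Pp_top m).1.ne')

lemma Pp_ne_zero (m : ℕ) : Pp m ≠ 0 := by
  intro h
  have := (Pp_top m).1
  simp [h] at this

lemma Wr_eq_Pp (t : ℝ) (ht : t ≠ 1) (m : ℕ) :
    Wr t m = (1-t)^m * (Pp m).eval (t/(1-t)) := by
  have h1 : 1 - t ≠ 0 := sub_ne_zero.2 ht.symm
  induction m using Nat.strong_induction_on with
  | _ m ih =>
    rcases m with _ | m
    · simp [Wr, Pp]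
    · rw [Wr_succ, Pp_conv, eval_mul, eval_X, eval_finsetSum, ← mul_assoc, Finset.mul_sum,
        Finset.mul_sum]
      apply Finset.sum_congr rfl
      intro i hi
      simp at hi
      rw [ih (m-i) (by omega), eval_mul, eval_C]
      have : (1-t)^(m+1) = (1-t)^i * (1-t)^(m-i) * (1-t) := by
        rw [← pow_add, ← pow_succ]; congr 1; omega
      rw [this]
      field_simp

lemma splits_derivative {p : ℝ[X]} (hp : p.Splits) : (derivative p).Splits := by
  by_cases h0 : p.natDegree = 0
  · rw [natDegree_eq_zero] at h0
    obtain ⟨c, rfl⟩ := h0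
    simp
  rw [splits_iff_card_roots] at hp ⊢
  have h1 := card_roots_le_derivative p
  have h2 := card_roots' (derivative p)
  have h3 := natDegree_derivative_lt h0
  omega

/-- The `u`-substitution. -/
noncomputable def Qp (m : ℕ) : ℝ[X] := X * (Pp m).comp (C (1/2) * (X^2 - 1))

lemma Qp_succ (m : ℕ) : Qp (m+1) = (C (1/2) * (X^2 - 1)) *
    derivative ((C (1/2) * (X^2 - 1)) * derivative (Qp m)) := by
  have hA : derivative (C (1/2) * (X^2 - 1) : ℝ[X]) = X := by
    simp only [derivative_mul, derivative_C, derivative_sub, derivative_X_pow, derivative_one]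
    simp
    rw [← mul_assoc, ← C_mul]
    norm_num
  have hX : (X^2 : ℝ[X]) = 1 + 2 * (C (1/2) * (X^2 - 1)) := by
    rw [show (2 : ℝ[X]) = C 2 from (map_ofNat C 2).symm, ← mul_assoc, ← C_mul]
    norm_num
  unfold Qp
  rw [Pp]
  generalize Pp m = P
  generalize (C (1/2) * (X^2 - 1) : ℝ[X]) = A at *
  have h2 : derivative (2 : ℝ[X]) = 0 := derivative_ofNat 2
  have e1 : derivative (X * P.comp A) = P.comp A + (1 + 2 * A) * (derivative P).comp A := by
    rw [derivative_mul, derivative_comp, hA, derivative_X, ← hX]; ring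
  have e2 : A * (P.comp A + (1 + 2 * A) * (derivative P).comp A) =
      (X * (P + (1 + 2 * X) * derivative P)).comp A := by
    simp
  rw [e1, e2, derivative_comp, hA, mul_comp, X_comp]
  ring

lemma Qp_splits (m : ℕ) : (Qp m).Splits := by
  have hA : (C (1/2) * (X^2 - 1) : ℝ[X]).Splits := by
    apply Splits.C_mul
    rw [show (X^2 - 1 : ℝ[X]) = (X - C 1) * (X + C 1) by simp; ring]
    exact (Splits.X_sub_C 1).mul (Splits.X_add_C 1)
  induction m with
  | zero => simp [Qp, Pp]
  | succ m ih =>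
    rw [Qp_succ]
    exact hA.mul (splits_derivative (hA.mul (splits_derivative ih)))

lemma Qp_ne_zero (m : ℕ) : Qp m ≠ 0 := by
  intro h
  have h1 : (Qp m).eval 2 = 0 := by rw [h]; simp
  rw [Qp, eval_mul, eval_comp, eval_X] at h1
  have h2 : (Pp m).eval (3/2) = 0 := by
    have : eval 2 (C (1/2) * (X^2 - 1) : ℝ[X]) = 3/2 := by simp; norm_num
    rw [this] at h1; linarith
  rw [eval_eq_sum_range] at h2
  have h3 : 0 < ∑ i ∈ Finset.range ((Pp m).natDegree + 1), (Pp m).coeff i * (3/2)^i := by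
    apply Finset.sum_pos'
    · intro i _
      have := Pp_nonneg m i
      positivity
    · refine ⟨m, by simp [Pp_natDegree], ?_⟩
      have := (Pp_top m).1
      positivity
  linarith

/-- complex roots of `P_m` are real, at least `-1/2`. -/
lemma Pp_complex_root (m : ℕ) (z : ℂ) (hz : ((Pp m).map (algebraMap ℝ ℂ)).IsRoot z) :
    ∃ r : ℝ, (r : ℂ) = z ∧ -(1/2) ≤ r := by
  obtain ⟨u, hu⟩ := IsAlgClosed.exists_pow_nat_eq (1 + 2*z) (n := 2) (by norm_num)
  have hroot : ((Qp m).map (algebraMap ℝ ℂ)).IsRoot u := by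
    rw [IsRoot.def, Qp, Polynomial.map_mul, map_comp, eval_mul, eval_comp]
    have : eval u (map (algebraMap ℝ ℂ) (C (1/2) * (X^2 - 1))) = z := by
      simp [hu]
    rw [this, hz.eq_zero, mul_zero]
  obtain ⟨v, hv⟩ := (Qp_splits m).mem_range_of_isRoot (Qp_ne_zero m) hroot
  refine ⟨(v^2-1)/2, ?_, by nlinarith [sq_nonneg v]⟩
  have hv' : (v : ℂ) = u := hv
  push_cast
  rw [hv', hu]; ring

lemma Pp_splits (m : ℕ) : (Pp m).Splits := by
  apply Splits.of_splits_map (algebraMap ℝ ℂ) (IsAlgClosed.splits _)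
  intro z hz
  obtain ⟨r, hr, _⟩ := Pp_complex_root m z (isRoot_of_mem_roots hz)
  exact ⟨r, hr⟩

lemma Pp_root (m : ℕ) (r : ℝ) (hr : r ∈ (Pp m).roots) : -(1/2) ≤ r ∧ r ≤ 0 := by
  have hr := isRoot_of_mem_roots hr
  constructor
  · obtain ⟨r', h1, h2⟩ := Pp_complex_root m r (hr.map (f := algebraMap ℝ ℂ))
    have : r' = r := by exact_mod_cast h1
    rwa [← this]
  · by_contra! hpos
    have h2 := hr.eq_zero
    rw [eval_eq_sum_range] at h2
    have h3 : 0 < ∑ i ∈ Finset.range ((Pp m).natDegree + 1), (Pp m).coeff i * r^i := by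
      apply Finset.sum_pos'
      · intro i _
        have := Pp_nonneg m i
        positivity
      · refine ⟨m, by simp [Pp_natDegree], ?_⟩
        have := (Pp_top m).1
        positivity
    linarith

/-- nonnegative, log-concave with no internal zeros. -/
def PF2 (c : ℕ → ℝ) : Prop :=
  (∀ i, 0 ≤ c i) ∧ ∀ i j, i ≤ j → c i * c (j+2) ≤ c (i+1) * c (j+1)

lemma PF2_mul (p : ℝ[X]) (a b : ℝ) (ha : 0 ≤ a) (hb : 0 ≤ b) (h : PF2 p.coeff) :
    PF2 ((C a + C b * X) * p).coeff := by
  obtain ⟨h0, h1⟩ := h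
  have e0 : ((C a + C b * X) * p).coeff 0 = a * p.coeff 0 := by
    rw [add_mul, coeff_add, coeff_C_mul, mul_assoc, coeff_C_mul, coeff_X_mul_zero]; ring
  have e1 : ∀ k, ((C a + C b * X) * p).coeff (k+1) = a * p.coeff (k+1) + b * p.coeff k := by
    intro k
    rw [add_mul, coeff_add, coeff_C_mul, mul_assoc, coeff_C_mul, coeff_X_mul]
  have h2 : ∀ i j, i ≤ j → p.coeff i * p.coeff (j+1) ≤ p.coeff (i+1) * p.coeff j := by
    intro i j hij
    rcases hij.eq_or_lt with rfl | hlt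
    · rw [mul_comm]
    · obtain ⟨l, rfl⟩ : ∃ l, j = l+1 := ⟨j-1, by omega⟩
      exact h1 i l (by omega)
  constructor
  · intro i
    rcases i with _ | i
    · rw [e0]; exact mul_nonneg ha (h0 _)
    · rw [e1]; exact add_nonneg (mul_nonneg ha (h0 _)) (mul_nonneg hb (h0 _))
  · intro i j hij
    have hab := mul_nonneg ha hb
    have haa := mul_nonneg ha ha
    have hbb := mul_nonneg hb hb
    rcases i with _ | i
    · rw [e0, e1, e1, e1]
      have k1 := mul_le_mul_of_nonneg_left (h2 0 (j+1) (by omega)) haa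
      have k2 := mul_nonneg hab (mul_nonneg (h0 (0+1)) (h0 j))
      have k3 := mul_nonneg hbb (mul_nonneg (h0 0) (h0 j))
      linarith
    · obtain ⟨l, rfl⟩ : ∃ l, j = l+1 := ⟨j-1, by omega⟩
      rw [e1, e1, e1, e1]
      have k1 := mul_le_mul_of_nonneg_left (h2 (i+1) (l+2) (by omega)) haa
      have k2 := mul_le_mul_of_nonneg_left
        ((h2 i (l+2) (by omega)).trans (h2 (i+1) (l+1) (by omega))) hab
      have k3 := mul_le_mul_of_nonneg_left (h2 i (l+1) (by omega)) hbb
      simp only [add_assoc, Nat.reduceAdd] at *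
      linarith

lemma PF2_C (c : ℝ) (hc : 0 ≤ c) : PF2 (C c : ℝ[X]).coeff := by
  constructor
  · intro i
    rw [coeff_C]
    split_ifs
    · exact hc
    · exact le_refl _
  · intro i j _
    simp [coeff_C]

lemma PF2_prod (c : ℝ) (hc : 0 ≤ c) (S : Multiset ℝ) (hS : ∀ r ∈ S, -(1/2) ≤ r ∧ r ≤ 0) :
    PF2 (C c * (S.map fun r => C (-r) + C (1+r) * X).prod).coeff := by
  induction S using Multiset.induction_on with
  | empty => simpa using PF2_C c hc
  | cons r S ih =>
    rw [Multiset.map_cons, Multiset.prod_cons, mul_left_comm]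
    have hr := hS r (by simp)
    exact PF2_mul _ _ _ (by linarith) (by linarith)
      (ih (fun r' h' => hS r' (Multiset.mem_cons_of_mem h')))

lemma eval_prod_aux (t : ℝ) (ht : t ≠ 1) (S : Multiset ℝ) :
    ((S.map fun r => C (-r) + C (1+r) * X).prod).eval t =
      (1-t)^(Multiset.card S) * (S.map fun r => t/(1-t) - r).prod := by
  have h1 : 1 - t ≠ 0 := sub_ne_zero.2 ht.symm
  induction S using Multiset.induction_on with
  | empty => simp
  | cons r S ih =>
    rw [Multiset.map_cons, Multiset.prod_cons, Multiset.map_cons, Multiset.prod_cons,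
      eval_mul, ih, Multiset.card_cons, pow_succ]
    simp only [eval_add, eval_mul, eval_C, eval_X]
    field_simp
    ring

lemma U_eq_zero (n k : ℕ) (h : n + 1 ≤ k) : U n k = 0 := by
  rw [U, Finset.card_eq_zero, Finset.filter_eq_empty_iff]
  rintro p _ ⟨_, h2⟩
  have := numDescents_lt n p
  omega

lemma U_PF2 (m : ℕ) : ∃ V : ℝ[X], PF2 V.coeff ∧ ∀ k, V.coeff (k+1) = (U (2*m+2) k : ℝ) := by
  have hs := Pp_splits (m+1)
  have hc : 0 ≤ (Pp (m+1)).leadingCoeff := Pp_nonneg _ _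
  refine ⟨_, PF2_prod _ hc (Pp (m+1)).roots (Pp_root (m+1)), ?_⟩
  have key : C (Pp (m+1)).leadingCoeff *
      ((Pp (m+1)).roots.map fun r => C (-r) + C (1+r) * X).prod =
      X * ∑ k ∈ Finset.range (2*m+3), C (U (2*m+2) k : ℝ) * X ^ k := by
    apply eq_of_infinite_eval_eq
    apply Set.Infinite.mono (s := {1}ᶜ)
    · intro t ht
      have ht : t ≠ 1 := ht
      have h1 := Wr_eq_U t m
      rw [Wr_eq_Pp t ht, hs.eval_eq_prod_roots] at h1
      rw [Set.mem_ofPred_eq, eval_mul, eval_C, eval_prod_aux t ht, ← hs.natDegree_eq_card_roots,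
        Pp_natDegree, mul_left_comm, h1]
      simp [eval_finsetSum]
    · exact (Set.finite_singleton 1).infinite_compl
  intro k
  rw [key, coeff_X_mul, finsetSum_coeff]
  simp only [coeff_C_mul, coeff_X_pow]
  by_cases hk : k < 2*m+3
  · rw [Finset.sum_eq_single k]
    · simp
    · intro b _ hb
      rw [if_neg (Ne.symm hb), mul_zero]
    · intro h; simp at h; omega
  · rw [U_eq_zero _ _ (by omega), Finset.sum_eq_zero]
    · simp
    · intro b hb
      simp at hb
      rw [if_neg (by omega), mul_zero]

end PartB

/-- for `n` even and `k ≥ 1`, `U(n,k-1)·U(n,k+1) ≤ U(n,k)²`. -/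
theorem stmt10 (n k : ℕ) (hn : Even n) (hk : 1 ≤ k) :
    U n (k - 1) * U n (k + 1) ≤ U n k ^ 2 := by
  obtain ⟨m, rfl⟩ := hn
  obtain ⟨k, rfl⟩ : ∃ l, k = l+1 := ⟨k-1, by omega⟩
  rcases m with _ | m
  · rw [U_eq_zero (0+0) (k+1+1) (by omega), mul_zero]
    exact Nat.zero_le _
  · obtain ⟨V, hV, hk⟩ := U_PF2 m
    have h := hV.2 (k+1) (k+1) le_rfl
    rw [show k+1+2 = (k+1+1)+1 by ring, hk, hk, hk] at h
    rw [show m+1+(m+1) = 2*m+2 by ring, Nat.add_sub_cancel, pow_two]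
    exact_mod_cast h
end

section
/- For every positive integer n and all 2 ≤ k ≤ n−2, R(n,k−1)·R(n,k+1) ≤ R(n,k)², i.e., the sequence of numbers of n-permutations with k runs is log-concave in k. -/
open Finset

namespace RunsLC

/-- number of direction changes in a word -/
def chg (M : ℕ) (u : ℕ → Bool) : ℕ := ∑ j ∈ range M, if u j = u (j+1) then 0 else 1

/-- word after inserting the maximum in gap `i` -/
def ins (i : ℕ) (u : ℕ → Bool) (j : ℕ) : Bool :=
  if j + 1 < i then u j else if j + 1 = i then true else if j = i then false else u (j-1)

theorem chg_succ (M : ℕ) (u : ℕ → Bool) :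
    chg (M+1) u = chg M (fun j => u (j+1)) + if u 0 = u 1 then 0 else 1 := by
  unfold chg
  rw [Finset.sum_range_succ']

theorem chg_congr (M : ℕ) (u v : ℕ → Bool) (h : ∀ j, j ≤ M → u j = v j) : chg M u = chg M v := by
  unfold chg
  apply Finset.sum_congr rfl
  intro j hj
  have := Finset.mem_range.1 hj
  rw [h j (by omega), h (j+1) (by omega)]

theorem ins_tail (i : ℕ) (u : ℕ → Bool) :
    (fun j => ins (i+2) u (j+1)) = ins (i+1) (fun j => u (j+1)) := by
  funext j
  unfold ins
  by_cases h1 : j + 1 < i + 1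
  · simp [h1, show j + 1 + 1 < i + 2 by omega]
  · by_cases h2 : j + 1 = i + 1
    · simp [show j = i by omega]
    · by_cases h3 : j = i + 1
      · simp [h3]
      · simp [h1, h2, h3, show ¬ (j + 1 + 1 < i + 2) by omega, show ¬ (j + 1 = i + 2 ) by omega,
          show ¬ (j = i) by omega, show j - 1 + 1 = j by omega]

theorem chg_ins_ss (M i : ℕ) (u : ℕ → Bool) :
    chg (M+1) (ins (i+2) u) = chg M (ins (i+1) (fun j => u (j+1))) +
      if u 0 = (if i = 0 then true else u 1) then 0 else 1 := by
  rw [chg_succ, ins_tail]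
  congr 1
  have h0 : ins (i+2) u 0 = u 0 := by simp [ins]
  have h1 : ins (i+2) u 1 = if i = 0 then true else u 1 := by
    unfold ins
    rcases i with _ | i <;> simp
  rw [h0, h1]

theorem ins_one_tail (u : ℕ → Bool) :
    (fun j => ins 1 u (j+1)) = fun j => if j = 0 then false else u j := by
  funext j
  unfold ins
  rcases j with _ | j <;> simp

theorem chg_ins_one (M : ℕ) (u : ℕ → Bool) :
    chg (M+1) (ins 1 u) = chg M (fun j => if j = 0 then false else u j) + 1 := by
  rw [chg_succ, ins_one_tail]
  simp [ins]

theorem chg_ins_one_false (M : ℕ) (u : ℕ → Bool) (h : u 0 = false) :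
    chg (M+1) (ins 1 u) = chg M u + 1 := by
  rw [chg_ins_one]
  congr 2
  funext j
  rcases j with _ | j <;> simp [h]

theorem chg_ins_one_succ (M : ℕ) (u : ℕ → Bool) :
    chg (M+2) (ins 1 u) = chg M (fun j => u (j+1)) + (if u 1 = false then 0 else 1) + 1 := by
  rw [chg_ins_one, chg_succ]
  cases h : u 1 <;> simp [h]

theorem chg_ins_zero (M : ℕ) (u : ℕ → Bool) :
    chg (M+1) (ins 0 u) = chg M u + (if u 0 = false then 0 else 1) := by
  rw [chg_succ]
  have : (fun j => ins 0 u (j+1)) = u := by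
    funext j; simp [ins]
  rw [this]
  cases h : u 0 <;> simp [ins, h]

theorem lemA (M : ℕ) : ∀ (u : ℕ → Bool) (f : ℕ → ℤ),
    ∑ i ∈ range (M+2), f (chg (M+1) (ins (i+1) u)) =
      ((chg M u : ℤ) + if u 0 = true then 1 else 0) * f (chg M u) +
      (1 + if u 0 = true then 0 else 1) * f (chg M u + 1) +
      ((M : ℤ) - chg M u) * f (chg M u + 2) := by
  induction M with
  | zero =>
    intro u f
    simp only [Finset.sum_range_succ, Finset.sum_range_zero]
    rw [chg_ins_one, chg_ins_ss]
    cases h : u 0 <;> simp [chg] <;> ring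
  | succ M ih =>
    intro u f
    rw [Finset.sum_range_succ', Finset.sum_range_succ']
    have key : ∀ g : ℕ → ℤ, ∑ i ∈ range (M+1), g (chg (M+1) (ins (i+2) (fun j => u (j+1)))) =
        _ - g (chg (M+1) (ins 1 (fun j => u (j+1)))) :=
      fun g => by
        have := ih (fun j => u (j+1)) g
        rw [Finset.sum_range_succ'] at this
        exact eq_sub_of_add_eq this
    have e1 : ∀ i, chg (M+1+1) (ins (i+1+1+1) u) =
        chg (M+1) (ins (i+2) (fun j => u (j+1))) + if u 0 = u 1 then 0 else 1 := by
      intro i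
      have := chg_ins_ss (M+1) (i+1) u
      simpa using this
    have e2 : chg (M+1+1) (ins (0+1+1) u) =
        chg (M+1) (ins 1 (fun j => u (j+1))) + if u 0 = true then 0 else 1 := by
      have := chg_ins_ss (M+1) 0 u
      simpa using this
    have e3 := chg_ins_one_succ M u
    have e4 := chg_ins_one_false M (fun j => u (j+1))
    have e5 := chg_succ M u
    have k0 := key f
    have k1 := key (fun c => f (c+1))
    rw [e2, e3]
    simp only [e1]
    cases h0 : u 0 <;> cases h1 : u 1 <;> simp only [h0, h1] at * <;>
      simp at e4 e5 k0 k1 ⊢ <;>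
      (try rw [e4] at *) <;> rw [e5] <;> (try rw [k0]) <;> (try rw [k1]) <;> push_cast <;> ring_nf

theorem lemB (M : ℕ) (u : ℕ → Bool) (f : ℕ → ℤ) :
    ∑ i ∈ range (M+3), f (chg (M+1) (ins i u)) =
      ((chg M u : ℤ) + 1) * f (chg M u) + 2 * f (chg M u + 1) +
      ((M : ℤ) - chg M u) * f (chg M u + 2) := by
  rw [Finset.sum_range_succ', lemA, chg_ins_zero]
  cases u 0 <;> simp <;> ring

/-- ascent word -/
def word (n : ℕ) (p : Equiv.Perm (Fin n)) (j : ℕ) : Bool :=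
  decide (permVal n p j < permVal n p (j+1))

theorem permVal_inj (n : ℕ) (p : Equiv.Perm (Fin n)) (i j : ℕ) (hi : i < n) (hj : j < n)
    (h : permVal n p i = permVal n p j) : i = j := by
  unfold permVal at h
  rw [dif_pos hi, dif_pos hj] at h
  have := p.injective (Fin.ext h)
  simpa using this

theorem numRuns_eq (M : ℕ) (p : Equiv.Perm (Fin (M+2))) :
    numRuns (M+2) p = chg M (word (M+2) p) + 1 := by
  unfold numRuns chg
  congr 1
  rw [Finset.card_filter, Finset.sum_Ico_eq_sum_range]
  apply Finset.sum_congr (by simp)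
  intro j hj
  have hj := Finset.mem_range.1 hj
  have h1 : permVal (M+2) p j ≠ permVal (M+2) p (j+1) := fun h => by
    have := permVal_inj _ p _ _ (by omega) (by omega) h
    omega
  have h2 : permVal (M+2) p (j+1) ≠ permVal (M+2) p (j+2) := fun h => by
    have := permVal_inj _ p _ _ (by omega) (by omega) h
    omega
  have : dirChange (M+2) p (1+j) ↔ ¬ (word (M+2) p j = word (M+2) p (j+1)) := by
    unfold dirChange word
    rw [show 1 + j - 1 = j by omega, show 1 + j = j + 1 by omega, decide_eq_decide]
    rw [show j + 1 + 1 = j + 2 by omega]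
    omega
  simp only [this]
  split_ifs <;> simp_all

/-- insert the maximum at position `i` -/
def insP (n : ℕ) (x : Fin (n+1) × Equiv.Perm (Fin n)) : Equiv.Perm (Fin (n+1)) :=
  ((finSuccEquiv' x.1).trans (Equiv.optionCongr x.2)).trans (finSuccEquiv' (Fin.last n)).symm

theorem insP_at (n : ℕ) (x : Fin (n+1) × Equiv.Perm (Fin n)) : insP n x x.1 = Fin.last n := by
  simp [insP]

theorem insP_above (n : ℕ) (x : Fin (n+1) × Equiv.Perm (Fin n)) (j : Fin n) :
    insP n x (x.1.succAbove j) = (x.2 j).castSucc := by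
  simp [insP]

theorem insP_inj (n : ℕ) : Function.Injective (insP n) := by
  rintro ⟨i, p⟩ ⟨i', p'⟩ h
  have h1 := insP_at n (i, p)
  have h2 := insP_at n (i', p')
  rw [← h, ← h1] at h2
  have hi : i = i' := ((insP n (i, p)).injective h2).symm
  subst hi
  congr 1
  ext j
  have a := insP_above n (i, p) j
  have b := insP_above n (i, p') j
  rw [← h] at b
  have := a.symm.trans b
  simpa using congrArg Fin.val this

theorem insP_bij (n : ℕ) : Function.Bijective (insP n) := by
  rw [Fintype.bijective_iff_injective_and_card]
  refine ⟨insP_inj n, ?_⟩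
  simp [Fintype.card_perm, Nat.factorial_succ]

theorem permVal_insP (n : ℕ) (i : Fin (n+1)) (p : Equiv.Perm (Fin n)) (j : ℕ) (hj : j < n + 1) :
    permVal (n+1) (insP n (i, p)) j =
      if j < i then permVal n p j else if j = i then n else permVal n p (j-1) := by
  have hi := i.2
  unfold permVal
  rw [dif_pos hj]
  by_cases h1 : j < i
  · rw [if_pos h1, dif_pos (by omega)]
    have := insP_above n (i, p) ⟨j, by omega⟩
    rw [Fin.succAbove_of_castSucc_lt _ _ (by simpa [Fin.lt_def] using h1)] at this
    simpa using congrArg Fin.val this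
  · rw [if_neg h1]
    by_cases h2 : j = i
    · rw [if_pos h2]
      have := insP_at n (i, p)
      have e : (⟨j, hj⟩ : Fin (n+1)) = i := Fin.ext h2
      rw [e, this]
      simp
    · rw [if_neg h2, dif_pos (by omega)]
      have := insP_above n (i, p) ⟨j-1, by omega⟩
      rw [Fin.succAbove_of_le_castSucc _ _ (by simp [Fin.le_def]; omega)] at this
      have e : (⟨j, hj⟩ : Fin (n+1)) = Fin.succ ⟨j-1, by omega⟩ := Fin.ext (by simp; omega)
      rw [e]
      simpa using congrArg Fin.val this

theorem permVal_lt (n : ℕ) (p : Equiv.Perm (Fin n)) (j : ℕ) (hj : j < n) : permVal n p j < n := by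
  unfold permVal
  rw [dif_pos hj]
  exact (p _).2

theorem word_insP (n : ℕ) (i : Fin (n+1)) (p : Equiv.Perm (Fin n)) (j : ℕ) (hj : j < n) :
    word (n+1) (insP n (i, p)) j = ins i (word n p) j := by
  have hi := i.2
  unfold word ins
  rw [permVal_insP _ _ _ _ (by omega), permVal_insP _ _ _ _ (by omega)]
  have hl := permVal_lt n p j hj
  rcases lt_trichotomy (j+1) i with h | h | h
  · simp [h, show j < i.1 by omega]
  · simp [h, show j < i.1 by omega, hl]
  · by_cases h2 : j = i
    · simp [h2]
      rw [← h2]; omega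
    · simp [h2, show ¬ (j < i.1) by omega, show ¬ (j + 1 < i.1) by omega,
        show ¬ (j + 1 = i.1) by omega, show j - 1 + 1 = j by omega]

/-- weighted sum over permutations -/
theorem sum_rec (M : ℕ) (f : ℕ → ℤ) :
    ∑ p : Equiv.Perm (Fin (M+3)), f (numRuns (M+3) p) =
    ∑ p : Equiv.Perm (Fin (M+2)), ((numRuns (M+2) p : ℤ) * f (numRuns (M+2) p)
      + 2 * f (numRuns (M+2) p + 1) + ((M : ℤ) + 1 - numRuns (M+2) p) * f (numRuns (M+2) p + 2)) := by
  rw [← (insP_bij (M+2)).sum_comp (fun p => f (numRuns (M+3) p)), Fintype.sum_prod_type,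
    Finset.sum_comm]
  apply Finset.sum_congr rfl
  intro p _
  have h := lemB M (word (M+2) p) (fun c => f (c+1))
  rw [Finset.sum_range] at h
  have h2 : ∀ i : Fin (M+3), numRuns (M+3) (insP (M+2) (i, p)) =
      chg (M+1) (ins i (word (M+2) p)) + 1 := by
    intro i
    rw [numRuns_eq (M+1)]
    congr 1
    apply chg_congr
    intro j hj
    exact word_insP (M+2) i p j (by omega)
  simp only [h2]
  rw [h, numRuns_eq M]
  push_cast
  ring_nf

/-- run numbers indexed by integers -/
def r (n : ℕ) (k : ℤ) : ℤ :=
  ∑ p : Equiv.Perm (Fin n), if (numRuns n p : ℤ) = k then 1 else 0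

theorem r_eq (n k : ℕ) : r n k = R n k := by
  unfold r R
  rw [Finset.card_filter]
  push_cast
  simp

/-- the recurrence operator -/
def T (c N : ℤ) (a : ℤ → ℤ) (k : ℤ) : ℤ := k * a k + c * a (k-1) + (N - k) * a (k-2)
/-- multiplication by `1+x` -/
def Mu (a : ℤ → ℤ) (k : ℤ) : ℤ := a k + a (k-1)
/-- Eulerian type operator -/
def E (N : ℤ) (a : ℤ → ℤ) (k : ℤ) : ℤ := k * a k + (N - k) * a (k-1)

theorem r_rec (M : ℕ) : r (M+3) = T 2 (M+3) (r (M+2)) := by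
  funext k
  have h := sum_rec M (fun c => if (c : ℤ) = k then 1 else 0)
  unfold T
  simp only [r] at *
  rw [h]
  simp only [Finset.mul_sum, ← Finset.sum_add_distrib]
  apply Finset.sum_congr rfl
  intro p _
  generalize numRuns (M+2) p = c
  push_cast
  have e1 : ((c:ℤ) = k - 1) ↔ ((c : ℤ) + 1 = k) := by omega
  have e2 : ((c:ℤ) = k - 2) ↔ ((c : ℤ) + 2 = k) := by omega
  simp only [e1, e2]
  split_ifs with h1 h2 h3 h4 h5 <;> first | omega | (subst_vars; ring)

theorem T_Mu (c N : ℤ) (a : ℤ → ℤ) : T c N (Mu a) = Mu (T (c+1) (N-1) a) := by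
  funext k
  unfold T Mu
  ring_nf

theorem T_Mu_iter (e : ℕ) : ∀ (c N : ℤ) (a : ℤ → ℤ),
    T c N (Mu^[e] a) = Mu^[e] (T (c+e) (N-e) a) := by
  induction e with
  | zero => intro c N a; simp
  | succ e ih =>
    intro c N a
    rw [Function.iterate_succ_apply', T_Mu, ih, Function.iterate_succ_apply']
    push_cast
    ring_nf

theorem T_E (h : ℤ) (a : ℤ → ℤ) : T (h+1) (h+3) a = Mu (E (h+2) a) := by
  funext k
  unfold T Mu E
  ring_nf

/-- positive on `[1,d]`, zero elsewhere, log-concave -/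
structure Good (d : ℤ) (a : ℤ → ℤ) : Prop where
  pos : ∀ k, 1 ≤ k → k ≤ d → 0 < a k
  z1 : ∀ k, k < 1 → a k = 0
  z2 : ∀ k, d < k → a k = 0
  lc : ∀ k, a (k-1) * a (k+1) ≤ a k ^ 2

theorem Good.nonneg {d : ℤ} {a : ℤ → ℤ} (h : Good d a) (k : ℤ) : 0 ≤ a k := by
  by_cases h1 : k < 1
  · rw [h.z1 k h1]
  · by_cases h2 : d < k
    · rw [h.z2 k h2]
    · exact (h.pos k (by omega) (by omega)).le

theorem Good.lc' {d : ℤ} {a : ℤ → ℤ} (h : Good d a) (i j k : ℤ) (hi : j = i + 1) (hk : k = i + 2) :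
    a i * a k ≤ a j ^ 2 := by
  have := h.lc (i+1)
  subst hi hk
  ring_nf at this ⊢
  exact this

theorem Good.tp {d : ℤ} {a : ℤ → ℤ} (h : Good d a) (i : ℤ) (n : ℕ) :
    a i * a (i+n+2) ≤ a (i+1) * a (i+n+1) := by
  induction n with
  | zero =>
    have := h.lc' i (i+1) (i+2) rfl rfl
    simpa [pow_two] using this
  | succ n ih =>
    push_cast
    by_cases hz : i < 1
    · rw [h.z1 i hz, zero_mul]
      exact mul_nonneg (h.nonneg _) (h.nonneg _)
    by_cases hz : d < i + (n+1) + 2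
    · rw [h.z2 _ hz, mul_zero]
      exact mul_nonneg (h.nonneg _) (h.nonneg _)
    have l := h.lc' (i+n+1) (i+n+2) (i+n+3) (by ring) (by ring)
    have p1 := h.pos (i+n+1) (by omega) (by omega)
    have p2 := h.pos (i+n+2) (by omega) (by omega)
    have p0 := h.pos i (by omega) (by omega)
    have p3 := h.pos (i+1) (by omega) (by omega)
    rw [show i + ((n:ℤ)+1)+2 = i+n+3 by ring, show i + ((n:ℤ)+1)+1 = i+n+2 by ring]
    generalize a (i+n+1) = x at *
    generalize a (i+n+2) = y at *
    generalize a (i+n+3) = z at *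
    have : (a i * z) * (x * y) ≤ (a (i+1) * y) * (x * y) := by
      calc (a i * z) * (x * y) = (a i * y) * (x * z) := by ring
        _ ≤ (a i * y) * y^2 := by gcongr
        _ ≤ (a (i+1) * x) * y^2 := by gcongr
        _ = _ := by ring
    exact le_of_mul_le_mul_right this (by positivity)

theorem Good.mu {d : ℤ} {a : ℤ → ℤ} (hd : 1 ≤ d) (h : Good d a) : Good (d+1) (Mu a) := by
  refine ⟨?_, ?_, ?_, ?_⟩
  · intro k h1 h2
    unfold Mu
    by_cases hk : k ≤ d
    · have := h.pos k h1 hk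
      have := h.nonneg (k-1)
      omega
    · have := h.pos (k-1) (by omega) (by omega)
      have := h.nonneg k
      omega
  · intro k hk
    simp [Mu, h.z1 k hk, h.z1 (k-1) (by omega)]
  · intro k hk
    simp [Mu, h.z2 k (by omega), h.z2 (k-1) (by omega)]
  · intro k
    unfold Mu
    have t0 := h.lc' (k-2) (k-1) k (by ring) (by ring)
    have t1 := h.lc' (k-1) k (k+1) (by ring) (by ring)
    have t2 := h.tp (k-2) 1
    rw [show k - 1 - 1 = k - 2 by ring, show k + 1 - 1 = k by ring]
    rw [show k - 2 + (1:ℕ) + 2 = k+1 by push_cast; ring, show k - 2 + 1 = k-1 by ring,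
      show k - 2 + (1:ℕ) + 1 = k by push_cast; ring] at t2
    nlinarith

theorem Good.mu_iter {a : ℤ → ℤ} (e : ℕ) {d : ℤ} (hd : 1 ≤ d) (h : Good d a) :
    Good (d+e) (Mu^[e] a) := by
  induction e with
  | zero => simpa using h
  | succ e ih =>
    rw [Function.iterate_succ_apply']
    have := ih.mu (by omega)
    push_cast
    rwa [← add_assoc]

theorem Good.e {d : ℤ} {a : ℤ → ℤ} (hd : 1 ≤ d) (h : Good d a) : Good d (E (d+1) a) := by
  have z1 : ∀ k, k < 1 → E (d+1) a k = 0 := by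
    intro k hk
    simp [E, h.z1 k hk, h.z1 (k-1) (by omega)]
  have z2 : ∀ k, d < k → E (d+1) a k = 0 := by
    intro k hk
    by_cases hk' : k = d + 1
    · subst hk'
      simp [E, h.z2 (d+1) (by omega)]
    · simp [E, h.z2 k (by omega), h.z2 (k-1) (by omega)]
  refine ⟨?_, z1, z2, ?_⟩
  · intro k h1 h2
    unfold E
    have n1 := h.nonneg (k-1)
    have n0 := h.nonneg k
    have := h.pos k h1 h2
    have : 0 < k * a k := by positivity
    have : 0 ≤ (d + 1 - k) * a (k-1) := mul_nonneg (by omega) n1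
    omega
  · intro k
    by_cases hk : k < 1
    · rw [z1 (k-1) (by omega), zero_mul]; positivity
    by_cases hk2 : d < k
    · rw [z2 (k+1) (by omega), mul_zero]; positivity
    unfold E
    obtain ⟨m, hm⟩ : ∃ m, m = d + 1 - k := ⟨_, rfl⟩
    rw [show d + 1 - (k-1) = m + 1 by omega, show d + 1 - (k+1) = m - 1 by omega, ← hm]
    have hm1 : 1 ≤ m := by omega
    have hk1 : 1 ≤ k := by omega
    have t0 := h.lc' (k-2) (k-1) k (by ring) (by ring)
    have t1 := h.lc' (k-1) k (k+1) (by ring) (by ring)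
    have t2 := h.tp (k-2) 1
    rw [show k - 1 - 1 = k - 2 by ring, show k + 1 - 1 = k by ring]
    rw [show k - 2 + (1:ℕ) + 2 = k+1 by push_cast; ring, show k - 2 + 1 = k-1 by ring,
      show k - 2 + (1:ℕ) + 1 = k by push_cast; ring] at t2
    generalize a (k-2) = p at *
    generalize a (k-1) = q at *
    generalize a k = r at *
    generalize a (k+1) = s at *
    have s0 := mul_le_mul_of_nonneg_left t0 (show 0 ≤ m^2-1 by nlinarith)
    have s1 := mul_le_mul_of_nonneg_left t1 (show 0 ≤ k^2-1 by nlinarith)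
    have s2 := mul_le_mul_of_nonneg_left t2 (show 0 ≤ (m+1)*(k+1) by positivity)
    have s3 := sq_nonneg (r - q)
    linarith

theorem Good.t {d : ℤ} {a : ℤ → ℤ} (hd : 1 ≤ d) (h : Good d a) :
    Good (d+1) (T (d+1) (d+2) a) := by
  have z1 : ∀ k, k < 1 → T (d+1) (d+2) a k = 0 := by
    intro k hk
    simp [T, h.z1 k hk, h.z1 (k-1) (by omega), h.z1 (k-2) (by omega)]
  have z2 : ∀ k, d + 1 < k → T (d+1) (d+2) a k = 0 := by
    intro k hk
    by_cases hk' : k = d + 2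
    · subst hk'
      simp [T, h.z2 (d+2) (by omega), h.z2 (d+2-1) (by omega)]
    · simp [T, h.z2 k (by omega), h.z2 (k-1) (by omega), h.z2 (k-2) (by omega)]
  refine ⟨?_, z1, z2, ?_⟩
  · intro k h1 h2
    unfold T
    have n2 := h.nonneg (k-2)
    have n1 := h.nonneg (k-1)
    have n0 := h.nonneg k
    have : 0 ≤ (d + 2 - k) * a (k-2) := mul_nonneg (by omega) n2
    by_cases hk : k ≤ d
    · have := h.pos k h1 hk
      have : 0 < k * a k := by positivity
      have : 0 ≤ (d + 1) * a (k-1) := mul_nonneg (by omega) n1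
      omega
    · have := h.pos (k-1) (by omega) (by omega)
      have : 0 ≤ k * a k := by positivity
      have : 0 < (d + 1) * a (k-1) := mul_pos (by omega) (by assumption)
      omega
  · intro k
    by_cases hk : k < 1
    · rw [z1 (k-1) (by omega), zero_mul]; positivity
    by_cases hk2 : d + 1 < k
    · rw [z2 (k+1) (by omega), mul_zero]; positivity
    unfold T
    obtain ⟨m, hm⟩ : ∃ m, m = d + 2 - k := ⟨_, rfl⟩
    rw [show d + 2 - (k-1) = m + 1 by omega, show d + 2 - (k+1) = m - 1 by omega, ← hm]
    obtain ⟨c, hc⟩ : ∃ c, c = d + 1 := ⟨_, rfl⟩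
    have hcm : c = k + m - 1 := by omega
    rw [← hc]
    have hm1 : 1 ≤ m := by omega
    have hk1 : 1 ≤ k := by omega
    have hc0 : 0 ≤ c := by omega
    have t0 := h.lc' (k-3) (k-2) (k-1) (by ring) (by ring)
    have t1 := h.lc' (k-2) (k-1) k (by ring) (by ring)
    have t2 := h.lc' (k-1) k (k+1) (by ring) (by ring)
    have t3 := h.tp (k-3) 1
    have t4 := h.tp (k-2) 1
    have t5 := h.tp (k-3) 2
    rw [show k - 1 - 1 = k - 2 by ring, show k + 1 - 1 = k by ring, show k - 1 - 2 = k - 3 by ring,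
      show k + 1 - 2 = k - 1 by ring]
    rw [show k - 2 + (1:ℕ) + 2 = k+1 by push_cast; ring, show k - 2 + 1 = k-1 by ring,
      show k - 2 + (1:ℕ) + 1 = k by push_cast; ring] at t4
    rw [show k - 3 + (1:ℕ) + 2 = k by push_cast; ring, show k - 3 + 1 = k-2 by ring,
      show k - 3 + (1:ℕ) + 1 = k-1 by push_cast; ring] at t3
    rw [show k - 3 + (2:ℕ) + 2 = k+1 by push_cast; ring, show k - 3 + 1 = k-2 by ring,
      show k - 3 + (2:ℕ) + 1 = k by push_cast; ring] at t5
    generalize a (k-3) = p at *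
    generalize a (k-2) = q at *
    generalize a (k-1) = r at *
    generalize a k = s at *
    generalize a (k+1) = t at *
    have s0 := mul_le_mul_of_nonneg_left t0 (show 0 ≤ m^2-1 by nlinarith)
    have s2 := mul_le_mul_of_nonneg_left t2 (show 0 ≤ k^2-1 by nlinarith)
    have s1 := mul_le_mul_of_nonneg_left t1 (show 0 ≤ c^2 - (k-1)*(m-1) by subst hcm; nlinarith)
    have s3 := mul_le_mul_of_nonneg_left t3 (show 0 ≤ c*(m+1) by positivity)
    have s4 := mul_le_mul_of_nonneg_left t4 (show 0 ≤ c*(k+1) by positivity)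
    have s5 := mul_le_mul_of_nonneg_left t5 (show 0 ≤ (m+1)*(k+1) by positivity)
    have s6 := sq_nonneg (s - q)
    linarith

theorem r_two : Good 1 (r 2) := by
  have h : ∀ k, r 2 k = if k = 1 then 2 else 0 := by
    intro k
    unfold r
    have : ∀ p, numRuns 2 p = 1 := by decide
    simp only [this]
    by_cases hk : k = 1
    · subst hk; simp [Fintype.card_perm]
    · have : ¬ (1 = k) := fun h => hk h.symm
      simp [hk, this]
  refine ⟨?_, ?_, ?_, ?_⟩
  · intro k h1 h2
    rw [h, if_pos (by omega)]; norm_num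
  · intro k hk
    rw [h, if_neg (by omega)]
  · intro k hk
    rw [h, if_neg (by omega)]
  · intro k
    rw [h (k-1), h (k+1)]
    have : 0 ≤ r 2 k ^ 2 := sq_nonneg _
    split_ifs <;> first | omega | simpa using this

theorem r_even (h : ℕ) : ∃ a, Good (h+1) a ∧ r (2*h+2) = Mu^[h] a := by
  induction h with
  | zero => exact ⟨r 2, by simpa using r_two, rfl⟩
  | succ h ih =>
    obtain ⟨a, ha, hr⟩ := ih
    have g1 := ha.t (by omega)
    have g2 := g1.e (by omega)
    refine ⟨_, by push_cast; exact g2, ?_⟩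
    rw [show 2 * (h+1) + 2 = (2*h+1) + 3 by ring, r_rec, show 2*h+1+2 = 2*h+3 by ring, r_rec, hr,
      T_Mu_iter, T_Mu_iter, Function.iterate_succ_apply,
      show (h:ℤ)+1+1+1 = (h + 1) + 2 by ring, ← T_E]
    push_cast
    ring_nf

theorem r_good (n : ℕ) (hn : 2 ≤ n) : ∃ d, Good d (r n) := by
  obtain ⟨h, hh | hh⟩ : ∃ h, n = 2*h+2 ∨ n = 2*h+3 := ⟨(n-2)/2, by omega⟩
  · obtain ⟨a, ha, hr⟩ := r_even h
    rw [hh, hr]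
    exact ⟨_, ha.mu_iter h (by omega)⟩
  · obtain ⟨a, ha, hr⟩ := r_even h
    rw [hh, r_rec, hr, T_Mu_iter]
    have g := (ha.t (by omega)).mu_iter h (by omega)
    refine ⟨(h:ℤ) + 1 + 1 + h, ?_⟩
    convert g using 3 <;> push_cast <;> ring

end RunsLC

theorem stmt11 (n k : ℕ) (hn : 1 ≤ n) (hk1 : 2 ≤ k) (hk2 : k ≤ n - 2) :
    R n (k - 1) * R n (k + 1) ≤ R n k ^ 2 := by
  obtain ⟨d, hd⟩ := RunsLC.r_good n (by omega)
  have := hd.lc k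
  rw [show (k:ℤ) - 1 = ((k-1 : ℕ) : ℤ) by omega, show (k:ℤ) + 1 = ((k+1 : ℕ) : ℤ) by push_cast; rfl,
    RunsLC.r_eq, RunsLC.r_eq, RunsLC.r_eq] at this
  exact_mod_cast this
end

section
/- For any fixed n, the sequence R(n,1), R(n,2), ..., R(n,n−1) is unimodal: there is an index m with R(n,1) ≤ ⋯ ≤ R(n,m) ≥ ⋯ ≥ R(n,n−1). -/
open Finset

structure SLC (a : ℤ → ℤ) (d : ℤ) : Prop where
  pos : ∀ k, 1 ≤ k → k ≤ d → 0 < a k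
  zero : ∀ k, (k < 1 ∨ d < k) → a k = 0
  lc : ∀ k, a (k-1) * a (k+1) ≤ a k * a k

namespace SLC
variable {a : ℤ → ℤ} {d : ℤ}

theorem nonneg (h : SLC a d) (k : ℤ) : 0 ≤ a k := by
  by_cases h1 : 1 ≤ k ∧ k ≤ d
  · exact (h.pos k h1.1 h1.2).le
  · rw [h.zero k (by omega)]

theorem lc2 (h : SLC a d) (k : ℤ) : a (k-1) * a (k+2) ≤ a k * a (k+1) := by
  by_cases h1 : 1 ≤ k ∧ k + 1 ≤ d
  · have p1 := h.pos k h1.1 (by omega)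
    have p2 := h.pos (k+1) (by omega) h1.2
    have l1 := h.lc k
    have l2 := h.lc (k+1)
    rw [show k + 1 - 1 = k by ring, show k + 1 + 1 = k + 2 by ring] at l2
    have := h.nonneg (k-1)
    have := h.nonneg (k+2)
    have l3 := mul_le_mul l1 l2 (by positivity) (by positivity)
    have : (a k * a (k+1)) * (a (k-1) * a (k+2)) ≤ (a k * a (k+1)) * (a k * a (k+1)) := by
      linarith
    exact le_of_mul_le_mul_left this (by positivity)
  · have : a (k-1) * a (k+2) = 0 := by
      by_cases h2 : 1 ≤ k
      · rw [h.zero (k+2) (by omega), mul_zero]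
      · rw [h.zero (k-1) (by omega), zero_mul]
    rw [this]
    exact mul_nonneg (h.nonneg _) (h.nonneg _)

theorem lc3 (h : SLC a d) (k : ℤ) : a (k-2) * a (k+2) ≤ a (k-1) * a (k+1) := by
  by_cases h1 : 1 ≤ k - 1 ∧ k + 1 ≤ d
  · have p1 := h.pos (k-1) h1.1 (by omega)
    have p2 := h.pos (k+1) (by omega) h1.2
    have p0 := h.pos k (by omega) (by omega)
    have l1 := h.lc2 (k-1)
    rw [show k - 1 - 1 = k - 2 by ring, show k - 1 + 2 = k + 1 by ring,
      show k - 1 + 1 = k by ring] at l1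
    have l2 := h.lc (k+1)
    rw [show k + 1 - 1 = k by ring, show k + 1 + 1 = k + 2 by ring] at l2
    have := h.nonneg (k-2)
    have := h.nonneg (k+2)
    have l3 := mul_le_mul l1 l2 (by positivity) (by positivity)
    have : (a k * a (k+1)) * (a (k-2) * a (k+2)) ≤ (a k * a (k+1)) * (a (k-1) * a (k+1)) := by
      linarith
    exact le_of_mul_le_mul_left this (by positivity)
  · have : a (k-2) * a (k+2) = 0 := by
      by_cases h2 : 1 ≤ k - 1
      · rw [h.zero (k+2) (by omega), mul_zero]
      · rw [h.zero (k-2) (by omega), zero_mul]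
    rw [this]
    exact mul_nonneg (h.nonneg _) (h.nonneg _)
end SLC

def opE (a : ℤ → ℤ) : ℤ → ℤ := fun k => a k + a (k-1)
def opT (α β : ℤ) (a : ℤ → ℤ) : ℤ → ℤ :=
  fun k => k * a k + α * a (k-1) + (β - (k-2)) * a (k-2)
def opV (γ : ℤ) (a : ℤ → ℤ) : ℤ → ℤ :=
  fun k => k * a k + (γ - (k-1)) * a (k-1)

theorem opT_opE (α β : ℤ) (a : ℤ → ℤ) : opT α β (opE a) = opE (opT (α+1) (β-1) a) := by
  funext k
  simp only [opT, opE]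
  rw [show k - 1 - 1 = k - 2 by ring, show k - 1 - 2 = k - 3 by ring,
    show k - 2 - 1 = k - 3 by ring]
  ring

theorem opT_opE_iter (m : ℕ) : ∀ (α β : ℤ) (a : ℤ → ℤ),
    opT α β (opE^[m] a) = opE^[m] (opT (α+m) (β-m) a) := by
  induction m with
  | zero => intro α β a; simp
  | succ m ih =>
    intro α β a
    rw [Function.iterate_succ_apply', opT_opE, ih, Function.iterate_succ_apply']
    push_cast
    rw [show α + 1 + (m:ℤ) = α + (m + 1) by ring, show β - 1 - (m:ℤ) = β - (m + 1) by ring]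

theorem opT_eq (γ : ℤ) (a : ℤ → ℤ) : opT γ γ a = opE (opV γ a) := by
  funext k
  simp only [opT, opE, opV]
  rw [show k - 1 - 1 = k - 2 by ring]
  ring

theorem SLC.of_mid {b : ℤ → ℤ} {d : ℤ} (pos : ∀ k, 1 ≤ k → k ≤ d → 0 < b k)
    (zero : ∀ k, (k < 1 ∨ d < k) → b k = 0)
    (lc : ∀ k, 1 ≤ k → k ≤ d → b (k-1) * b (k+1) ≤ b k * b k) : SLC b d := by
  refine ⟨pos, zero, fun k => ?_⟩
  by_cases h : 1 ≤ k ∧ k ≤ d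
  · exact lc k h.1 h.2
  · have : b (k-1) * b (k+1) = 0 := by
      by_cases h2 : 1 ≤ k
      · rw [zero (k+1) (by omega), mul_zero]
      · rw [zero (k-1) (by omega), zero_mul]
    rw [this]
    exact mul_self_nonneg _

theorem SLC.opE {a : ℤ → ℤ} {d : ℤ} (hd : 1 ≤ d) (h : SLC a d) : SLC (opE a) (d+1) := by
  apply SLC.of_mid
  · intro k h1 h2
    simp only [_root_.opE]
    have := h.nonneg k
    have := h.nonneg (k-1)
    by_cases h3 : k ≤ d
    · have := h.pos k h1 h3; omega
    · have := h.pos (k-1) (by omega) (by omega); omega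
  · intro k hk
    simp only [_root_.opE]
    rw [h.zero k (by omega), h.zero (k-1) (by omega), add_zero]
  · intro k _ _
    simp only [_root_.opE]
    have l1 := h.lc k
    have l2 := h.lc (k-1)
    have l3 := h.lc2 (k-1)
    rw [show k - 1 + 2 = k + 1 by ring, show k - 1 - 1 = k - 2 by ring,
      show k - 1 + 1 = k by ring] at *
    rw [show k + 1 - 1 = k by ring]
    nlinarith

theorem SLC.opV {a : ℤ → ℤ} {d : ℤ} (h : SLC a d) : SLC (opV d a) d := by
  apply SLC.of_mid
  · intro k h1 h2
    simp only [_root_.opV]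
    have p := h.pos k h1 h2
    have q := h.nonneg (k-1)
    have : 0 ≤ d - (k-1) := by omega
    positivity
  · intro k hk
    simp only [_root_.opV]
    rw [h.zero k (by omega)]
    rcases hk with hk | hk
    · rw [h.zero (k-1) (by omega)]; ring
    · by_cases h2 : k = d + 1
      · subst h2; ring
      · rw [h.zero (k-1) (by omega)]; ring
  · intro k h1 h2
    simp only [_root_.opV]
    have l1 := h.lc k
    have l2 := h.lc (k-1)
    have l3 := h.lc2 (k-1)
    have n1 := h.nonneg k
    have n2 := h.nonneg (k-1)
    rw [show k - 1 + 2 = k + 1 by ring, show k - 1 - 1 = k - 2 by ring,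
      show k - 1 + 1 = k by ring] at *
    rw [show k + 1 - 1 = k by ring]
    generalize a k = x2 at *
    generalize a (k-1) = x1 at *
    generalize a (k-2) = x0 at *
    generalize a (k+1) = x3 at *
    obtain ⟨e, rfl⟩ : ∃ e, d = k - 1 + e := ⟨d - (k-1), by ring⟩
    have he : 1 ≤ e := by omega
    have t1 : 0 ≤ (k^2-1) * (x2*x2 - x1*x3) := mul_nonneg (by nlinarith) (by linarith)
    have t2 : 0 ≤ (e^2-1) * (x1*x1 - x0*x2) := mul_nonneg (by nlinarith) (by linarith)
    have t3 : 0 ≤ ((k+1)*(e+1)) * (x1*x2 - x0*x3) := mul_nonneg (by positivity) (by linarith)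
    nlinarith [sq_nonneg (x1 - x2)]

theorem SLC.opT {a : ℤ → ℤ} {d : ℤ} (hd : 1 ≤ d) (h : SLC a d) : SLC (opT (d+1) d a) (d+1) := by
  apply SLC.of_mid
  · intro k h1 h2
    simp only [_root_.opT]
    have p := h.nonneg k
    have q := h.nonneg (k-1)
    have r := h.nonneg (k-2)
    have : 0 ≤ d - (k-2) := by omega
    by_cases h3 : k ≤ d
    · have := h.pos k h1 h3; positivity
    · have := h.pos (k-1) (by omega) (by omega); positivity
  · intro k hk
    simp only [_root_.opT]
    rw [h.zero k (by omega), h.zero (k-1) (by omega)]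
    rcases hk with hk | hk
    · rw [h.zero (k-2) (by omega)]; ring
    · by_cases h2 : k = d + 2
      · subst h2; ring
      · rw [h.zero (k-2) (by omega)]; ring
  · intro k h1 h2
    simp only [_root_.opT]
    have l1 := h.lc k
    have l2 := h.lc (k-1)
    have l2' := h.lc (k-2)
    have l3 := h.lc2 (k-1)
    have l3' := h.lc2 (k-2)
    have l4 := h.lc3 (k-1)
    rw [show k - 1 + 2 = k + 1 by ring, show k - 1 - 1 = k - 2 by ring,
      show k - 1 + 1 = k by ring] at *
    rw [show k - 2 - 1 = k - 3 by ring, show k - 2 + 2 = k by ring] at *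
    rw [show k - 2 + 1 = k - 1 by ring] at *
    rw [show k - 1 - 2 = k - 3 by ring] at *
    rw [show k + 1 - 1 = k by ring, show k + 1 - 2 = k - 1 by ring]
    generalize a k = x3 at *
    generalize a (k-1) = x2 at *
    generalize a (k-2) = x1 at *
    generalize a (k-3) = x0 at *
    generalize a (k+1) = x4 at *
    obtain ⟨e, rfl⟩ : ∃ e, d = k - 2 + e := ⟨d - (k-2), by ring⟩
    have he : 1 ≤ e := by omega
    have ha : 0 ≤ k - 2 + e + 1 := by omega
    have t1 : 0 ≤ (k^2-1) * (x3*x3 - x2*x4) := mul_nonneg (by nlinarith) (by linarith)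
    have t2 : 0 ≤ (e^2-1) * (x1*x1 - x0*x2) := mul_nonneg (by nlinarith) (by linarith)
    have t3 : 0 ≤ ((k-2+e+1)^2 - (k-1)*(e-1)) * (x2*x2 - x1*x3) :=
      mul_nonneg (by nlinarith) (by linarith)
    have t4 : 0 ≤ ((k-2+e+1)*(k+1)) * (x2*x3 - x1*x4) := mul_nonneg (by positivity) (by linarith)
    have t5 : 0 ≤ ((k-2+e+1)*(e+1)) * (x1*x2 - x0*x3) := mul_nonneg (by positivity) (by linarith)
    have t6 : 0 ≤ ((k+1)*(e+1)) * (x1*x3 - x0*x4) := mul_nonneg (by positivity) (by linarith)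
    have t7 := sq_nonneg (x1 - x3)
    linarith

def rs : ℕ → ℤ → ℤ
  | 0 => fun k => if k = 1 then 2 else 0
  | n+1 => opT 2 (n+1) (rs n)

theorem SLC.iter {a : ℤ → ℤ} {d : ℤ} (hd : 1 ≤ d) (h : SLC a d) (m : ℕ) :
    SLC (_root_.opE^[m] a) (d+m) := by
  induction m with
  | zero => simpa using h
  | succ m ih =>
    rw [Function.iterate_succ_apply']
    have := ih.opE (by omega)
    push_cast
    rwa [← add_assoc]

theorem rs_even (m : ℕ) : ∃ a, SLC a (m+1) ∧ rs (2*m) = opE^[m] a := by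
  induction m with
  | zero =>
    refine ⟨rs 0, SLC.of_mid ?_ ?_ ?_, rfl⟩
    · intro k h1 h2
      have : k = 1 := by push_cast at h2; omega
      simp [rs, this]
    · intro k hk
      have : k ≠ 1 := by push_cast at hk; omega
      simp [rs, this]
    · intro k h1 h2
      have : k = 1 := by push_cast at h2; omega
      simp [rs, this]
  | succ m ih =>
    obtain ⟨a, ha, he⟩ := ih
    have h1 := ha.opT (by omega)
    refine ⟨opV (m+1+1) (opT (m+1+1) (m+1) a), ?_, ?_⟩
    · push_cast
      exact h1.opV
    · rw [show 2 * (m+1) = 2*m + 1 + 1 by ring, rs, rs, he, opT_opE_iter, opT_opE_iter,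
        Function.iterate_succ_apply, ← opT_eq]
      push_cast
      congr 2 <;> [skip; skip; congr 1] <;> ring

theorem rs_slc (n : ℕ) : SLC (rs n) (n+1) := by
  rcases Nat.even_or_odd' n with ⟨m, rfl | rfl⟩
  · obtain ⟨a, ha, he⟩ := rs_even m
    rw [he]
    convert ha.iter (by omega) m using 1
    push_cast; ring
  · obtain ⟨a, ha, he⟩ := rs_even m
    rw [rs, he, opT_opE_iter]
    have h1 := ha.opT (by omega)
    convert h1.iter (by omega) m using 1
    · congr 2 <;> push_cast <;> ring
    · push_cast; ring

theorem SLC.unimodal {a : ℤ → ℤ} {d : ℤ} (h : SLC a d) (hd : 1 ≤ d) :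
    ∃ m : ℕ, (∀ k : ℕ, 1 ≤ k → k < m → a k ≤ a (k+1)) ∧ 1 ≤ m ∧
      (∀ k : ℕ, m ≤ k → a (k+1) ≤ a k) := by
  classical
  have ex : ∃ m : ℕ, 1 ≤ m ∧ a ((m:ℤ)+1) ≤ a m := by
    refine ⟨d.toNat, by omega, ?_⟩
    rw [h.zero _ (by omega)]
    exact h.nonneg _
  refine ⟨Nat.find ex, ?_, (Nat.find_spec ex).1, ?_⟩
  · intro k h1 h2
    have := Nat.find_min ex h2
    push Not at this
    exact (this h1).le
  · intro k hk
    have hm := Nat.find_spec ex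
    induction k, hk using Nat.le_induction with
    | base => exact hm.2
    | succ k hk ih =>
      have h0 := h.nonneg k
      have h1 := h.nonneg (k+1)
      have l := h.lc (k+1)
      push_cast
      rw [show (k:ℤ) + 1 - 1 = k by ring] at l
      by_cases h3 : (k:ℤ) ≤ d
      · have := h.pos k (by omega) h3
        by_contra hc
        push Not at hc
        nlinarith
      · rw [h.zero (k+1+1) (by omega)]
        exact h1

def chg : List ℕ → ℕ
  | a :: b :: c :: l => (if (a < b ∧ c < b) ∨ (b < a ∧ b < c) then 1 else 0) + chg (b :: c :: l)
  | _ => 0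

theorem chg_cons (a b c : ℕ) (l : List ℕ) : chg (a :: b :: c :: l) =
  (if (a < b ∧ c < b) ∨ (b < a ∧ b < c) then 1 else 0) + chg (b :: c :: l) := rfl

theorem chg_swap {M b c : ℕ} (h1 : c < b) (h2 : c < M) (u : List ℕ) :
    chg (M :: c :: u) = chg (b :: c :: u) := by
  cases u with
  | nil => rfl
  | cons d u =>
    rw [chg_cons, chg_cons]
    congr 1
    have := h1.not_gt
    have := h2.not_gt
    simp [*]

theorem ins_aux (M : ℕ) (t : List ℕ) : ∀ (a b : ℕ) (f : ℕ → ℤ), (a :: b :: t).Nodup →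
    (∀ x ∈ a :: b :: t, x < M) →
    f (1 + chg (M :: b :: t)) + ((t.permutations'Aux M).map (fun l => f (chg (a :: b :: l)))).sum =
    (chg (a :: b :: t) + if a < b then 1 else 0) * f (chg (a :: b :: t)) +
    (if a < b then 1 else 2) * f (chg (a :: b :: t) + 1) +
    (t.length - chg (a :: b :: t)) * f (chg (a :: b :: t) + 2) := by
  induction t with
  | nil =>
    intro a b f hn hM
    have hb : b < M := hM b (by simp)
    have ha : a < M := hM a (by simp)
    have hab : a ≠ b := by simp at hn; exact hn
    rcases hab.lt_or_gt with h | h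
    · simp [chg, h, h.not_gt, hb.not_gt]; ring
    · simp [chg, h, h.not_gt, hb]; ring
  | cons c u ih =>
    intro a b f hn hM
    have hb : b < M := hM b (by simp)
    have ha : a < M := hM a (by simp)
    have hc : c < M := hM c (by simp)
    have hab : a ≠ b := by simp at hn; tauto
    have hbc : b ≠ c := by simp at hn; tauto
    have IH := ih b c (fun x => f ((if (a < b ∧ c < b) ∨ (b < a ∧ b < c) then 1 else 0) + x))
      hn.of_cons (fun x hx => hM x (List.mem_cons_of_mem _ hx))
    simp only [List.permutations'Aux, List.map_cons, List.sum_cons, List.map_map,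
      Function.comp_def, List.length_cons] at IH ⊢
    simp only [chg_cons a b c]
    simp only [chg_cons a b M, chg_cons b M c, chg_cons M b c]
    have hsw : c < b → chg (M :: c :: u) = chg (b :: c :: u) := fun h => chg_swap h hc u
    rw [← eq_sub_iff_add_eq'] at IH
    rw [IH]
    clear IH ih
    generalize chg (b :: c :: u) = e at *
    generalize chg (M :: c :: u) = q at *
    rcases hab.lt_or_gt with h | h <;> rcases hbc.lt_or_gt with h' | h' <;>
      simp [h, h', h.not_gt, h'.not_gt, hb, hc, hb.not_gt] at hsw ⊢ <;> try subst hsw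
    all_goals ring_nf

theorem ins_sum (M : ℕ) (l : List ℕ) (f : ℕ → ℤ) (hl : 2 ≤ l.length) (hn : l.Nodup)
    (hM : ∀ x ∈ l, x < M) :
    ((l.permutations'Aux M).map (fun l => f (chg l))).sum =
    (chg l + 1) * f (chg l) + 2 * f (chg l + 1) + (l.length - 2 - chg l) * f (chg l + 2) := by
  match l, hl with
  | a :: b :: t, _ =>
    have := ins_aux M t a b f hn hM
    have hb : b < M := hM b (by simp)
    have ha : a < M := hM a (by simp)
    have hab : a ≠ b := by simp at hn; tauto
    simp only [List.permutations'Aux, List.map_cons, List.sum_cons, List.map_map,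
      Function.comp_def, List.length_cons, chg_cons M a b, chg_cons a M b]
    rw [← eq_sub_iff_add_eq'] at this
    rw [this]
    push_cast
    rcases hab.lt_or_gt with h | h <;>
      simp [h, h.not_gt, hb, ha, ha.not_gt] <;> ring_nf

def dl : ℕ → List ℕ
  | 0 => []
  | n+1 => n :: dl n

theorem mem_dl (n x : ℕ) : x ∈ dl n ↔ x < n := by
  induction n with
  | zero => simp [dl]
  | succ n ih => simp [dl, ih]; omega
theorem nodup_dl (n : ℕ) : (dl n).Nodup := by
  induction n with
  | zero => simp [dl]
  | succ n ih => simp [dl, ih, mem_dl]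
theorem length_dl (n : ℕ) : (dl n).length = n := by
  induction n with
  | zero => simp [dl]
  | succ n ih => simp [dl, ih]

theorem sum_list_comb (L : List (List ℕ)) (A B C : ℤ) (f g h : List ℕ → ℤ) :
    A * (L.map f).sum + B * (L.map g).sum + C * (L.map h).sum =
      (L.map (fun l => A * f l + B * g l + C * h l)).sum := by
  induction L with
  | nil => simp
  | cons x L ih => simp only [List.map_cons, List.sum_cons, ← ih]; ring

theorem my_sum_flatMap (L : List (List ℕ)) (g : List ℕ → List ℤ) :
    (L.flatMap g).sum = (L.map (fun l => (g l).sum)).sum := by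
  induction L with
  | nil => simp
  | cons x L ih => simp [ih]

theorem rs_eq (n : ℕ) (k : ℤ) : rs n k =
    ((dl (n+2)).permutations'.map (fun l => if (chg l : ℤ) + 1 = k then (1:ℤ) else 0)).sum := by
  induction n generalizing k with
  | zero =>
    simp only [rs, dl, List.permutations', List.permutations'Aux, List.flatMap_cons,
      List.flatMap_nil, List.map_cons, List.map_nil, List.append_nil, List.sum_cons, List.sum_nil,
      chg]
    by_cases h : k = 1
    · simp [h]
    · simp [h, Ne.symm h]
  | succ n ih =>
    have : dl (n+1+2) = (n+2) :: dl (n+2) := rfl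
    rw [this, List.permutations', List.map_flatMap, my_sum_flatMap]
    simp only [rs, opT]
    rw [ih, ih, ih, sum_list_comb]
    congr 1
    apply List.map_congr_left
    intro l hl
    rw [List.mem_permutations'] at hl
    rw [ins_sum (n+2) l (fun c => if (c : ℤ) + 1 = k then (1:ℤ) else 0)
      (by rw [hl.length_eq, length_dl]; omega) (hl.nodup_iff.2 (nodup_dl _))
      (fun x hx => (mem_dl _ _).1 (hl.mem_iff.1 hx)), hl.length_eq, length_dl]
    push_cast
    generalize (chg l : ℤ) = c
    have e1 : (c + 1 = k - 1) ↔ (c + 1 + 1 = k) := by omega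
    have e2 : (c + 1 = k - 2) ↔ (c + 2 + 1 = k) := by omega
    simp only [e1, e2]
    split_ifs <;> first | omega | (subst k; ring)

theorem chg_eq (l : List ℕ) : chg l = ((Finset.Ico 1 (l.length-1)).filter (fun i =>
    (l.getD (i-1) 0 < l.getD i 0 ∧ l.getD (i+1) 0 < l.getD i 0) ∨
    (l.getD i 0 < l.getD (i-1) 0 ∧ l.getD i 0 < l.getD (i+1) 0))).card := by
  induction l with
  | nil => simp [chg]
  | cons a l ih =>
    match l with
    | [] => simp [chg]
    | [b] => simp [chg]
    | b :: c :: l =>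
      rw [chg_cons, ih]
      simp only [Finset.card_filter, List.length_cons]
      rw [Finset.sum_eq_sum_Ico_succ_bot (a := 1) (b := l.length + 1 + 1 + 1 - 1) (by omega)]
      congr 1
      rw [show l.length + 1 + 1 + 1 - 1 = (l.length + 1 + 1 - 1) + 1 by omega,
        ← Finset.sum_Ico_add' _ 1 (l.length + 1 + 1 - 1) 1]
      apply Finset.sum_congr rfl
      intro i hi
      rw [Finset.mem_Ico] at hi
      obtain ⟨j, rfl⟩ : ∃ j, i = j + 1 := ⟨i - 1, by omega⟩
      simp

def word (n : ℕ) (p : Equiv.Perm (Fin n)) : List ℕ := List.ofFn (fun i => (p i : ℕ))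

theorem word_getD (n : ℕ) (p : Equiv.Perm (Fin n)) (i : ℕ) :
    (word n p).getD i 0 = permVal n p i := by
  unfold word permVal
  by_cases h : i < n
  · simp [h, List.getD]
  · simp [h, List.getD]

theorem numRuns_eq (n : ℕ) (p : Equiv.Perm (Fin n)) : numRuns n p = chg (word n p) + 1 := by
  rw [chg_eq]
  simp only [word_getD]
  unfold numRuns
  congr 2
  have : (word n p).length = n := by simp [word]
  rw [this]
  rfl

theorem word_inj (n : ℕ) : Function.Injective (word n) := by
  intro p q h
  have := List.ofFn_injective h
  ext i
  exact congrFun this i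

theorem word_nodup (n : ℕ) (p : Equiv.Perm (Fin n)) : (word n p).Nodup := by
  unfold word
  rw [List.nodup_ofFn]
  exact Fin.val_injective.comp p.injective

theorem word_perm (n : ℕ) (p : Equiv.Perm (Fin n)) : (word n p).Perm (dl n) := by
  rw [List.perm_ext_iff_of_nodup (word_nodup n p) (nodup_dl n)]
  intro x
  rw [mem_dl, word, List.mem_ofFn]
  constructor
  · rintro ⟨i, rfl⟩
    exact (p i).2
  · intro hx
    exact ⟨p.symm ⟨x, hx⟩, by simp⟩

theorem word_surj (n : ℕ) (l : List ℕ) (h : l.Perm (dl n)) : ∃ p, word n p = l := by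
  have hl : l.length = n := by rw [h.length_eq, length_dl]
  have hn : l.Nodup := h.nodup_iff.2 (nodup_dl n)
  subst hl
  let f : Fin l.length → Fin l.length := fun i =>
    ⟨l.get i, (mem_dl _ _).1 (h.mem_iff.1 (List.get_mem l i))⟩
  have hf : Function.Injective f := by
    intro i j hij
    exact List.nodup_iff_injective_get.1 hn (congrArg Fin.val hij)
  refine ⟨Equiv.ofBijective f (Finite.injective_iff_bijective.1 hf), ?_⟩
  simp [word, f]

theorem R_eq (n k : ℕ) : (R n k : ℤ) =
    ((dl n).permutations'.map (fun l => if (chg l : ℤ) + 1 = k then (1:ℤ) else 0)).sum := by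
  have hnd : (dl n).permutations'.Nodup :=
    (List.permutations_perm_permutations' _).nodup_iff.1 (List.nodup_permutations _ (nodup_dl n))
  rw [← List.sum_toFinset _ hnd]
  unfold R
  rw [Finset.card_filter]
  push_cast
  refine Finset.sum_bij (fun p _ => word n p) ?_ ?_ ?_ ?_
  · intro p _
    rw [List.mem_toFinset, List.mem_permutations']
    exact word_perm n p
  · intro p _ q _ h
    exact word_inj n h
  · intro l hl
    rw [List.mem_toFinset, List.mem_permutations'] at hl
    obtain ⟨p, hp⟩ := word_surj n l hl
    exact ⟨p, Finset.mem_univ _, hp⟩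
  · intro p _
    rw [numRuns_eq]
    congr 1
    apply propext
    omega

/-- for any fixed `n`, the sequence `R(n,1), ..., R(n,n-1)` is unimodal. -/
theorem stmt13 (n : ℕ) :
    ∃ m : ℕ, (∀ k, 1 ≤ k → k < m → R n k ≤ R n (k + 1)) ∧
             (∀ k, m ≤ k → k + 1 ≤ n - 1 → R n (k + 1) ≤ R n k) := by
  by_cases hn : n < 2
  · exact ⟨1, fun k h1 h2 => by omega, fun k h1 h2 => by omega⟩
  · obtain ⟨n, rfl⟩ : ∃ j, n = j + 2 := ⟨n - 2, by omega⟩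
    obtain ⟨m, h1, hm, h2⟩ := (rs_slc n).unimodal (by omega)
    have key : ∀ k : ℕ, (R (n+2) k : ℤ) = rs n k := fun k => by rw [R_eq, rs_eq]
    refine ⟨m, fun k hk hkm => ?_, fun k hk _ => ?_⟩
    · have := h1 k hk hkm
      zify
      rw [key, key]
      exact_mod_cast this
    · have := h2 k hk
      zify
      rw [key, key]
      exact_mod_cast this
end
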